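/- arXiv:0807.3578 — 3 statements merged into one kernel-verified Lean document; each statement's English description precedes it below -/
import Mathlib

section
/- If a, b, c, d ∈ ℂ[X] are nonconstant and satisfy a ∘ b = c ∘ d, then there exist â, b̂, ĉ, d̂, g, h ∈ ℂ[X] such that: g ∘ â = a, g ∘ ĉ = c, and deg g = gcd(deg a, deg c); b̂ ∘ h = b, d̂ ∘ h = d, and deg h = gcd(deg b, deg d); and â ∘ b̂ = ĉ ∘ d̂. -/
open Polynomial

theorem Subalgebra.exists_comp_eq_of_natDegree_dvd (S : Subalgebra ℂ ℂ[X]) {h : ℂ[X]}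
    (hS : h ∈ S) (hpos : 0 < h.natDegree) (hdvd : ∀ p ∈ S, h.natDegree ∣ p.natDegree)
    {p : ℂ[X]} (hp : p ∈ S) : ∃ q : ℂ[X], q.comp h = p := by
  induction hn : p.natDegree using Nat.strong_induction_on generalizing p with
  | _ n ih =>
  rcases Nat.eq_zero_or_pos n with rfl | hn0
  · exact ⟨p, by rw [eq_C_of_natDegree_eq_zero hn, C_comp]⟩
  obtain ⟨j, hj⟩ := hdvd p hp
  have hp0 : p ≠ 0 := by rintro rfl; simp at hn; omega
  have hh0 : h ≠ 0 := by rintro rfl; simp at hpos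
  set c : ℂ := p.leadingCoeff / h.leadingCoeff ^ j with hc
  have hlc : h.leadingCoeff ^ j ≠ 0 := pow_ne_zero _ (leadingCoeff_ne_zero.2 hh0)
  have hc0 : c ≠ 0 := div_ne_zero (leadingCoeff_ne_zero.2 hp0) hlc
  have hmem : p - C c * h ^ j ∈ S :=
    S.sub_mem hp (S.mul_mem (S.algebraMap_mem c) (S.pow_mem hS j))
  have hdeg : (p - C c * h ^ j).degree < p.degree := by
    apply degree_sub_lt_left
    · rw [degree_eq_natDegree hp0, degree_eq_natDegree (by simp [hc0, hh0]),
        natDegree_C_mul hc0, natDegree_pow, hj, mul_comm]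
    · exact hp0
    · simp only [leadingCoeff_mul, leadingCoeff_C, leadingCoeff_pow, hc]
      field_simp
  have hlt : (p - C c * h ^ j).natDegree < n := by
    rcases eq_or_ne (p - C c * h ^ j) 0 with h0 | h0
    · rwa [h0, natDegree_zero]
    · exact hn ▸ natDegree_lt_natDegree h0 hdeg
  obtain ⟨q, hq⟩ := ih _ hlt hmem rfl
  exact ⟨q + C c * X ^ j, by simp [hq]⟩

/-- A field `K` containing `ℂ[X]` (the variable being sent to `x`) on which `ℂˣ` acts in such a
way that `F(x)` is fixed by the `F.natDegree`-th roots of unity, together with an extension of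
the degree to `K`. -/
structure PlaceAtInfinity (F : ℂ[X]) (K : Type*) [Field K] [Algebra ℂ K] where
  x : K
  rot : ℂˣ →* (K →ₐ[ℂ] K)
  deg : K → ℤ
  deg_mul : ∀ {z w : K}, z ≠ 0 → w ≠ 0 → deg (z * w) = deg z + deg w
  deg_rot : ∀ (ζ : ℂˣ) (z : K), deg (rot ζ z) = deg z
  deg_aeval : ∀ p : ℂ[X], deg (aeval x p) = p.natDegree
  aeval_injective : Function.Injective (aeval x : ℂ[X] → K)
  pow_eq_one_of_rot_aeval : ∀ (ζ : ℂˣ) (p : ℂ[X]), p ≠ 0 →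
    rot ζ (aeval x p) = aeval x p → ζ ^ p.natDegree = 1
  rot_aeval_self : ∀ ζ : ℂˣ, ζ ^ F.natDegree = 1 → rot ζ (aeval x F) = aeval x F

theorem exists_isPrimitiveRoot_units {n : ℕ} (hn : n ≠ 0) : ∃ ζ : ℂˣ, IsPrimitiveRoot ζ n :=
  ⟨_, (Complex.isPrimitiveRoot_exp n hn).isUnit_unit hn⟩

theorem exists_pow_eq_of_pow_eq_one {n : ℕ} (hn : 0 < n) {ω ζ : ℂˣ} (hω : IsPrimitiveRoot ω n)
    (hζ : ζ ^ n = 1) : ∃ i < n, ω ^ i = ζ := by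
  have : NeZero n := ⟨hn.ne'⟩
  obtain ⟨i, hin, hi⟩ := (IsPrimitiveRoot.coe_units_iff.2 hω).eq_pow_of_pow_eq_one
    (ξ := (ζ : ℂ)) (by rw [← Units.val_pow_eq_pow_val, hζ, Units.val_one])
  exact ⟨i, hin, Units.ext (by simpa using hi)⟩

namespace PlaceAtInfinity

variable {F : ℂ[X]} {K : Type*} [Field K] [Algebra ℂ K] (P : PlaceAtInfinity F K)

theorem rot_rot (ζ η : ℂˣ) (z : K) : P.rot ζ (P.rot η z) = P.rot (ζ * η) z := by
  rw [map_mul]; rfl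

theorem aeval_rot (ζ : ℂˣ) (p : ℂ[X]) : aeval (P.rot ζ P.x) p = P.rot ζ (aeval P.x p) :=
  aeval_algHom_apply _ _ _

theorem deg_prod {s : ℤ} (k : ℕ) (w : ℕ → K) (hw : ∀ i, w i ≠ 0) (hs : ∀ i, P.deg (w i) = s) :
    P.deg (∏ i ∈ Finset.range k, w i) = k * s := by
  induction k with
  | zero => simpa using P.deg_aeval 1
  | succ k ih =>
    rw [Finset.prod_range_succ, P.deg_mul (Finset.prod_ne_zero_iff.2 fun i _ => hw i) (hw k), ih,
      hs]
    push_cast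
    ring

theorem aeval_ne_zero {p : ℂ[X]} (hp : p ≠ 0) : aeval P.x p ≠ 0 :=
  (map_ne_zero_iff (aeval P.x) P.aeval_injective).2 hp

theorem eq_of_rot_x_eq {ζ η : ℂˣ} (h : P.rot ζ P.x = P.rot η P.x) : ζ = η := by
  have h1 : P.rot (η⁻¹ * ζ) (aeval P.x (X : ℂ[X])) = aeval P.x (X : ℂ[X]) := by
    rw [aeval_X, ← P.rot_rot, h, P.rot_rot, inv_mul_cancel, map_one, AlgHom.one_apply]
  have h2 := P.pow_eq_one_of_rot_aeval _ _ X_ne_zero h1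
  rw [natDegree_X, pow_one] at h2
  exact (inv_mul_eq_one.1 h2).symm

/-- The polynomials `p` such that `p(x)` is fixed by the rotation `ζ`. -/
noncomputable def fixed (ζ : ℂˣ) : Subalgebra ℂ ℂ[X] :=
  AlgHom.equalizer ((P.rot ζ).comp (aeval P.x)) (aeval P.x)

theorem mem_fixed {ζ : ℂˣ} {p : ℂ[X]} :
    p ∈ P.fixed ζ ↔ P.rot ζ (aeval P.x p) = aeval P.x p := Iff.rfl

theorem mem_fixed_pow {ζ : ℂˣ} {p : ℂ[X]} (hp : p ∈ P.fixed ζ) (i : ℕ) : p ∈ P.fixed (ζ ^ i) := by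
  rw [mem_fixed] at hp ⊢
  induction i with
  | zero => simp
  | succ i ih => rw [pow_succ, ← P.rot_rot, hp, ih]

theorem dvd_natDegree_of_mem_fixed {ζ : ℂˣ} {r : ℕ} (hζ : IsPrimitiveRoot ζ r) {p : ℂ[X]}
    (hp : p ∈ P.fixed ζ) : r ∣ p.natDegree := by
  rcases eq_or_ne p 0 with rfl | h0
  · simp
  · exact hζ.dvd_of_pow_eq_one _ (P.pow_eq_one_of_rot_aeval _ _ h0 hp)

theorem exists_comp_eq_of_mem_fixed {ζ : ℂˣ} {h p : ℂ[X]} (hζ : IsPrimitiveRoot ζ h.natDegree)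
    (hpos : 0 < h.natDegree) (hh : h ∈ P.fixed ζ) (hp : p ∈ P.fixed ζ) :
    ∃ q : ℂ[X], q.comp h = p :=
  (P.fixed ζ).exists_comp_eq_of_natDegree_dvd hh hpos
    (fun _ hq => P.dvd_natDegree_of_mem_fixed hζ hq) hp

/-- A right composition factor of `F` is fixed by the roots of unity of order its degree. -/
theorem mem_fixed_of_comp_eq {a b : ℂ[X]} (ha : 0 < a.natDegree) (hb : 0 < b.natDegree)
    (hab : a.comp b = F) {ζ : ℂˣ} (hζ : ζ ^ b.natDegree = 1) : b ∈ P.fixed ζ := by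
  have hF : F.natDegree = a.natDegree * b.natDegree := by rw [← hab, natDegree_comp]
  obtain ⟨ω, hω⟩ := exists_isPrimitiveRoot_units (n := F.natDegree)
    (by rw [hF]; exact (Nat.mul_pos ha hb).ne')
  have hb0 : b ≠ 0 := by rintro rfl; simp at hb
  have key : P.rot (ω ^ a.natDegree) (aeval P.x b) = aeval P.x b := by
    classical
    set Q : K[X] := a.map (algebraMap ℂ K) - C (aeval P.x F) with hQ
    have hQdeg : Q.natDegree = a.natDegree := by rw [hQ, natDegree_sub_C, natDegree_map]
    have hQ0 : Q ≠ 0 := by rintro h; rw [h] at hQdeg; simp at hQdeg; omega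
    have hroot (i : ℕ) : P.rot (ω ^ i) (aeval P.x b) ∈ Q.roots.toFinset := by
      rw [Multiset.mem_toFinset, mem_roots hQ0, IsRoot, hQ, eval_sub, eval_C, eval_map_algebraMap,
        aeval_algHom_apply, ← aeval_comp, hab, P.rot_aeval_self, sub_self]
      rw [← pow_mul, mul_comm, pow_mul, hω.pow_eq_one, one_pow]
    have hcard : Q.roots.toFinset.card < (Finset.range (a.natDegree + 1)).card := by
      rw [Finset.card_range, Nat.lt_succ_iff, ← hQdeg]
      exact (Multiset.toFinset_card_le _).trans (card_roots' Q)
    obtain ⟨i, hi, j, hj, hij, he⟩ := Finset.exists_ne_map_eq_of_card_lt_of_maps_to hcard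
      (fun i _ => hroot i)
    wlog hlt : i < j generalizing i j
    · exact this j hj i hi hij.symm he.symm (by omega)
    rw [Finset.mem_range] at hj
    have hfix : P.rot (ω ^ (j - i)) (aeval P.x b) = aeval P.x b := by
      apply (P.rot (ω ^ i) : K →+* K).injective
      rw [AlgHom.coe_toRingHom]
      rw [P.rot_rot, ← pow_add, Nat.add_sub_cancel' hlt.le, he]
    have h1 := P.pow_eq_one_of_rot_aeval _ _ hb0 hfix
    rw [← pow_mul] at h1
    have h2 := hω.dvd_of_pow_eq_one _ h1
    rw [hF] at h2
    have h3 := Nat.le_of_dvd (by omega) (Nat.dvd_of_mul_dvd_mul_right hb h2)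
    rwa [show j - i = a.natDegree by omega] at hfix
  have hprim : IsPrimitiveRoot (ω ^ a.natDegree) b.natDegree :=
    hω.pow (by rw [hF]; exact Nat.mul_pos ha hb) hF
  obtain ⟨i, -, rfl⟩ := exists_pow_eq_of_pow_eq_one hb hprim hζ
  exact P.mem_fixed_pow key i

/-- The polynomial `b(Y) - b(x)` in `Y`. -/
noncomputable def fiber (b : ℂ[X]) : K[X] := b.map (algebraMap ℂ K) - C (aeval P.x b)

theorem natDegree_fiber (b : ℂ[X]) : (P.fiber b).natDegree = b.natDegree := by
  rw [fiber, natDegree_sub_C, natDegree_map]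

theorem fiber_ne_zero {b : ℂ[X]} (hb : 0 < b.natDegree) : P.fiber b ≠ 0 := by
  intro h
  have := P.natDegree_fiber b
  rw [h, natDegree_zero] at this
  omega

theorem nodup_rot_pow {ζ : ℂˣ} {r : ℕ} (hζ : IsPrimitiveRoot ζ r) :
    ((Multiset.range r).map fun i => P.rot (ζ ^ i) P.x).Nodup :=
  (Multiset.nodup_map_iff_of_inj_on fun _ hi _ hj h =>
    hζ.pow_inj (Multiset.mem_range.1 hi) (Multiset.mem_range.1 hj) (P.eq_of_rot_x_eq h)).2
    (Multiset.nodup_range r)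

theorem roots_fiber {b : ℂ[X]} (hb : 0 < b.natDegree) {ζ : ℂˣ}
    (hζ : IsPrimitiveRoot ζ b.natDegree) (hfix : b ∈ P.fixed ζ) :
    (P.fiber b).roots = (Multiset.range b.natDegree).map fun i => P.rot (ζ ^ i) P.x := by
  symm
  apply Multiset.eq_of_le_of_card_le
  · rw [Multiset.le_iff_subset (P.nodup_rot_pow hζ)]
    intro z hz
    obtain ⟨i, -, rfl⟩ := Multiset.mem_map.1 hz
    rw [mem_roots (P.fiber_ne_zero hb), IsRoot, fiber, eval_sub, eval_C, eval_map_algebraMap,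
      P.aeval_rot, sub_eq_zero]
    exact P.mem_fixed_pow hfix i
  · rw [Multiset.card_map, Multiset.card_range, ← P.natDegree_fiber b]
    exact card_roots' _

theorem splits_fiber {b : ℂ[X]} (hb : 0 < b.natDegree) {ζ : ℂˣ}
    (hζ : IsPrimitiveRoot ζ b.natDegree) (hfix : b ∈ P.fixed ζ) : (P.fiber b).Splits := by
  rw [splits_iff_card_roots, P.roots_fiber hb hζ hfix, P.natDegree_fiber, Multiset.card_map,
    Multiset.card_range]

theorem isRoot_fiber_iff {b : ℂ[X]} (hb : 0 < b.natDegree)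
    (hfix : ∀ ζ : ℂˣ, ζ ^ b.natDegree = 1 → b ∈ P.fixed ζ) (z : K) :
    (P.fiber b).IsRoot z ↔ ∃ ζ : ℂˣ, ζ ^ b.natDegree = 1 ∧ P.rot ζ P.x = z := by
  obtain ⟨ω, hω⟩ := exists_isPrimitiveRoot_units hb.ne'
  rw [← mem_roots (P.fiber_ne_zero hb), P.roots_fiber hb hω (hfix ω hω.pow_eq_one)]
  simp only [Multiset.mem_map, Multiset.mem_range]
  constructor
  · rintro ⟨i, -, rfl⟩
    exact ⟨ω ^ i, by rw [← pow_mul, mul_comm, pow_mul, hω.pow_eq_one, one_pow], rfl⟩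
  · rintro ⟨ζ, hζ, rfl⟩
    obtain ⟨i, hi, rfl⟩ := exists_pow_eq_of_pow_eq_one hb hω hζ
    exact ⟨i, hi, rfl⟩

/-- The intersection of `ℂ[b]` and `ℂ[d]` contains a polynomial of degree `deg b * deg d`. -/
theorem exists_comp_eq_comp {b d : ℂ[X]} (hb : 0 < b.natDegree) (hd : 0 < d.natDegree)
    (hbfix : ∀ ζ : ℂˣ, ζ ^ b.natDegree = 1 → b ∈ P.fixed ζ)
    (hdfix : ∀ ζ : ℂˣ, ζ ^ d.natDegree = 1 → d ∈ P.fixed ζ) :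
    ∃ p q : ℂ[X], p.comp b = q.comp d ∧ (q.comp d).natDegree = b.natDegree * d.natDegree := by
  obtain ⟨ω, hω⟩ := exists_isPrimitiveRoot_units hb.ne'
  obtain ⟨η, hη⟩ := exists_isPrimitiveRoot_units hd.ne'
  have hb0 : b ≠ 0 := by rintro rfl; simp at hb
  have hd0 : d ≠ 0 := by rintro rfl; simp at hd
  set q : ℂ[X] := resultant (d.map C - C X) (b.map C) d.natDegree b.natDegree with hq
  have hval : aeval P.x (q.comp d) = algebraMap ℂ K (d.leadingCoeff ^ b.natDegree) *
      ∏ i ∈ Finset.range d.natDegree, P.rot (η ^ i) (aeval P.x b) := by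
    have h1 : aeval P.x (q.comp d) =
        resultant (P.fiber d) (b.map (algebraMap ℂ K)) (P.fiber d).natDegree b.natDegree := by
      rw [aeval_comp, P.natDegree_fiber, hq]
      have h2 := resultant_map_map (d.map C - C X) (b.map C) d.natDegree b.natDegree
        (aeval (aeval P.x d) : ℂ[X] →ₐ[ℂ] K).toRingHom
      have h3 : (aeval (aeval P.x d) : ℂ[X] →ₐ[ℂ] K).toRingHom.comp C = algebraMap ℂ K := by
        ext z
        simp
      have h4 : (aeval (aeval P.x d) : ℂ[X] →ₐ[ℂ] K).toRingHom X = aeval P.x d := by simp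
      rw [Polynomial.map_sub, map_map, map_map, map_C, h3, h4] at h2
      exact h2.symm
    rw [h1, resultant_eq_prod_eval _ _ _ natDegree_map_le
      (P.splits_fiber hd hη (hdfix η hη.pow_eq_one)),
      P.roots_fiber hd hη (hdfix η hη.pow_eq_one), map_pow]
    congr 2
    · rw [← coeff_natDegree, P.natDegree_fiber, fiber, coeff_sub, coeff_map, coeff_C,
        if_neg hd.ne', sub_zero, coeff_natDegree]
    · simp only [Multiset.map_map, Function.comp_def, eval_map_algebraMap, P.aeval_rot]
      rfl
  have hfix : q.comp d ∈ P.fixed ω := by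
    rw [mem_fixed, hval, map_mul, AlgHom.commutes, map_prod]
    congr 1
    refine Finset.prod_congr rfl fun i _ => ?_
    rw [P.rot_rot, mul_comm, ← P.rot_rot, P.mem_fixed.1 (hbfix ω hω.pow_eq_one)]
  obtain ⟨p, hp⟩ := P.exists_comp_eq_of_mem_fixed hω hb (hbfix ω hω.pow_eq_one) hfix
  refine ⟨p, q, hp, ?_⟩
  have hrot0 (i : ℕ) : P.rot (η ^ i) (aeval P.x b) ≠ 0 :=
    (map_ne_zero_iff (P.rot (η ^ i)) (P.rot (η ^ i) : K →+* K).injective).2 (P.aeval_ne_zero hb0)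
  have hconst : P.deg (algebraMap ℂ K (d.leadingCoeff ^ b.natDegree)) = 0 := by
    simpa using P.deg_aeval (C (d.leadingCoeff ^ b.natDegree))
  have hdeg := congrArg P.deg hval
  rw [P.deg_aeval, P.deg_mul _ (Finset.prod_ne_zero_iff.2 fun i _ => hrot0 i), hconst, zero_add,
    P.deg_prod (s := b.natDegree) _ _ hrot0 (fun i => by rw [P.deg_rot, P.deg_aeval])] at hdeg
  · rw [mul_comm b.natDegree]
    exact_mod_cast hdeg
  · exact (_root_.map_ne_zero _).2 (pow_ne_zero _ (leadingCoeff_ne_zero.2 hd0))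

/-- The product of the conjugates of `x` under the roots of unity of order `gcd (deg b) (deg d)`
is a polynomial in `x`. -/
theorem exists_aeval_eq_prod_rot {b d : ℂ[X]} (hb : 0 < b.natDegree)
    (hd : 0 < d.natDegree)
    (hbfix : ∀ ζ : ℂˣ, ζ ^ b.natDegree = 1 → b ∈ P.fixed ζ)
    (hdfix : ∀ ζ : ℂˣ, ζ ^ d.natDegree = 1 → d ∈ P.fixed ζ) {ω : ℂˣ}
    (hω : IsPrimitiveRoot ω (Nat.gcd b.natDegree d.natDegree)) :
    ∃ h : ℂ[X], aeval P.x h =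
      ∏ i ∈ Finset.range (Nat.gcd b.natDegree d.natDegree), P.rot (ω ^ i) P.x := by
  classical
  set r := Nat.gcd b.natDegree d.natDegree with hr
  have hrpos : 0 < r := Nat.gcd_pos_of_pos_left _ hb
  have hb0 : b ≠ 0 := by rintro rfl; simp at hb
  obtain ⟨η, hη⟩ := exists_isPrimitiveRoot_units hb.ne'
  let φ : ℂ[X] →+* K := (aeval P.x : ℂ[X] →ₐ[ℂ] K)
  let : Algebra ℂ[X] K := φ.toAlgebra
  let : Algebra (FractionRing ℂ[X]) K := (IsFractionRing.lift (g := φ) P.aeval_injective).toAlgebra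
  have : IsScalarTower ℂ[X] (FractionRing ℂ[X]) K :=
    IsScalarTower.of_algebraMap_eq fun p => (IsFractionRing.lift_algebraMap _ p).symm
  let ψ : FractionRing ℂ[X] →+* K := algebraMap _ K
  have hψ (p : ℂ[X]) : ψ (algebraMap ℂ[X] (FractionRing ℂ[X]) p) = aeval P.x p :=
    IsFractionRing.lift_algebraMap _ p
  let lift (b : ℂ[X]) : (FractionRing ℂ[X])[X] :=
    (b.map C - C b : ℂ[X][X]).map (algebraMap ℂ[X] (FractionRing ℂ[X]))
  have hlift (b : ℂ[X]) : (lift b).map ψ = P.fiber b := by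
    simp only [lift, fiber, Polynomial.map_sub, map_map, map_C, hψ]
    congr 2
    ext z
    simp [hψ]
  let G := EuclideanDomain.gcd (lift b) (lift d)
  have hG : G.map ψ = EuclideanDomain.gcd (P.fiber b) (P.fiber d) := by
    rw [← hlift, ← hlift, gcd_map]
  have hGdvd : G.map ψ ∣ P.fiber b := hG ▸ EuclideanDomain.gcd_dvd_left _ _
  have hG0 : G.map ψ ≠ 0 := ne_zero_of_dvd_ne_zero (P.fiber_ne_zero hb) hGdvd
  have hroots : (G.map ψ).roots = (Multiset.range r).map fun i => P.rot (ω ^ i) P.x := by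
    have hnd : (G.map ψ).roots.Nodup := by
      refine Multiset.nodup_of_le (roots.le_of_dvd (P.fiber_ne_zero hb) hGdvd) ?_
      rw [P.roots_fiber hb hη (hbfix η hη.pow_eq_one)]
      exact P.nodup_rot_pow hη
    refine (Multiset.Nodup.ext hnd (P.nodup_rot_pow hω)).2 fun z => ?_
    rw [mem_roots hG0, hG, isRoot_gcd_iff_isRoot_left_right, P.isRoot_fiber_iff hb hbfix,
      P.isRoot_fiber_iff hd hdfix]
    simp only [Multiset.mem_map, Multiset.mem_range]
    constructor
    · rintro ⟨⟨ζ, hζ, rfl⟩, ⟨ξ, hξ, he⟩⟩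
      obtain rfl := P.eq_of_rot_x_eq he
      obtain ⟨i, hi, rfl⟩ := exists_pow_eq_of_pow_eq_one hrpos hω (pow_gcd_eq_one.2 ⟨hζ, hξ⟩)
      exact ⟨i, hi, rfl⟩
    · rintro ⟨i, -, rfl⟩
      have h1 : (ω ^ i) ^ r = 1 := by rw [← pow_mul, mul_comm, pow_mul, hω.pow_eq_one, one_pow]
      have h2 := pow_gcd_eq_one.1 h1
      exact ⟨⟨_, h2.1, rfl⟩, ⟨_, h2.2, rfl⟩⟩
  have hsplit : (G.map ψ).Splits :=
    (P.splits_fiber hb hη (hbfix η hη.pow_eq_one)).of_dvd (P.fiber_ne_zero hb) hGdvd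
  have hprod : ψ ((-1) ^ G.natDegree * (G.coeff 0 / G.leadingCoeff)) =
      ∏ i ∈ Finset.range r, P.rot (ω ^ i) P.x := by
    have h1 := hsplit.coeff_zero_eq_leadingCoeff_mul_prod_roots
    rw [coeff_map, natDegree_map, leadingCoeff_map, hroots] at h1
    have h2 : ψ G.leadingCoeff ≠ 0 := by
      rw [← leadingCoeff_map]
      exact leadingCoeff_ne_zero.2 hG0
    rw [map_mul, map_div₀, h1, map_pow, map_neg, map_one, mul_assoc, mul_div_assoc,
      mul_div_cancel_left₀ _ h2, ← mul_assoc, ← mul_pow]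
    simp [Finset.prod]
  have hint : IsIntegral ℂ[X] (∏ i ∈ Finset.range r, P.rot (ω ^ i) P.x) := by
    refine IsIntegral.prod _ fun i _ => ?_
    refine IsIntegral.of_aeval_monic (p := (C b.leadingCoeff⁻¹ * b).map C)
      ((monic_C_mul_of_mul_leadingCoeff_eq_one (inv_mul_cancel₀ (leadingCoeff_ne_zero.2 hb0))).map _)
      (by rw [natDegree_map, natDegree_C_mul (inv_ne_zero (leadingCoeff_ne_zero.2 hb0))]
          exact hb.ne') ?_
    have hφC : (algebraMap ℂ[X] K).comp C = algebraMap ℂ K := RingHom.ext fun z => aeval_C P.x z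
    have hfix : C b.leadingCoeff⁻¹ * b ∈ P.fixed (ω ^ i) :=
      mul_mem ((P.fixed _).algebraMap_mem _) (P.mem_fixed_pow (hbfix ω
        (pow_gcd_eq_one.1 hω.pow_eq_one).1) i)
    rw [aeval_def, eval₂_map, hφC, ← aeval_def, P.aeval_rot, P.mem_fixed.1 hfix]
    exact isIntegral_algebraMap (R := ℂ[X]) (x := C b.leadingCoeff⁻¹ * b)
  rw [← hprod] at hint
  obtain ⟨h, hh⟩ := IsIntegrallyClosed.isIntegral_iff.1
    ((isIntegral_algebraMap_iff (algebraMap (FractionRing ℂ[X]) K).injective).1 hint)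
  exact ⟨h, by rw [← hprod, ← hh, hψ]⟩

/-- There is a polynomial of degree `gcd (deg b) (deg d)` through which both `b` and `d` factor. -/
theorem exists_common_right_factor {b d : ℂ[X]} (hb : 0 < b.natDegree)
    (hd : 0 < d.natDegree)
    (hbfix : ∀ ζ : ℂˣ, ζ ^ b.natDegree = 1 → b ∈ P.fixed ζ)
    (hdfix : ∀ ζ : ℂˣ, ζ ^ d.natDegree = 1 → d ∈ P.fixed ζ) :
    ∃ p q h : ℂ[X], p.comp h = b ∧ q.comp h = d ∧
      h.natDegree = Nat.gcd b.natDegree d.natDegree := by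
  have hrpos : 0 < Nat.gcd b.natDegree d.natDegree := Nat.gcd_pos_of_pos_left _ hb
  obtain ⟨ω, hω⟩ := exists_isPrimitiveRoot_units hrpos.ne'
  obtain ⟨h, hh⟩ := P.exists_aeval_eq_prod_rot hb hd hbfix hdfix hω
  have hx0 : P.x ≠ 0 := by simpa using P.aeval_ne_zero X_ne_zero
  have hx1 : P.deg P.x = 1 := by simpa using P.deg_aeval X
  have hrot0 (i : ℕ) : P.rot (ω ^ i) P.x ≠ 0 :=
    (map_ne_zero_iff (P.rot (ω ^ i)) (P.rot (ω ^ i) : K →+* K).injective).2 hx0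
  have hdeg : h.natDegree = Nat.gcd b.natDegree d.natDegree := by
    have := congrArg P.deg hh
    rw [P.deg_aeval, P.deg_prod (s := 1) _ _ hrot0 (fun i => by rw [P.deg_rot, hx1])] at this
    exact_mod_cast this.trans (mul_one _)
  have hfix : h ∈ P.fixed ω := by
    rw [mem_fixed, hh, map_prod]
    apply mul_right_cancel₀ hx0
    have h1 := Finset.prod_range_succ' (fun i => P.rot (ω ^ i) P.x)
      (Nat.gcd b.natDegree d.natDegree)
    rw [Finset.prod_range_succ, hω.pow_eq_one, pow_zero, map_one, AlgHom.one_apply] at h1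
    rw [h1]
    simp only [P.rot_rot, pow_succ']
  have hω1 := pow_gcd_eq_one.1 hω.pow_eq_one
  rw [← hdeg] at hω hrpos
  obtain ⟨p, hp⟩ := P.exists_comp_eq_of_mem_fixed hω hrpos hfix (hbfix ω hω1.1)
  obtain ⟨q, hq⟩ := P.exists_comp_eq_of_mem_fixed hω hrpos hfix (hdfix ω hω1.2)
  exact ⟨p, q, h, hp, hq, hdeg⟩

end PlaceAtInfinity

namespace LaurentSeries

theorem algebraMap_complex_apply (r : ℂ) :
    algebraMap ℂ (LaurentSeries ℂ) r = HahnSeries.C r := by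
  rw [HahnSeries.algebraMap_apply', ← HahnSeries.ofPowerSeries_C]
  rfl

/-- The substitution `X ↦ ζ X` on Laurent series. -/
noncomputable def rotate (ζ : ℂˣ) : LaurentSeries ℂ →ₐ[ℂ] LaurentSeries ℂ where
  toFun f :=
    { coeff := fun n => (ζ ^ n : ℂˣ) * f.coeff n
      isPWO_support' := f.isPWO_support.mono fun n hn h => hn (by simp [h]) }
  map_one' := by
    ext n
    rcases eq_or_ne n 0 with rfl | hn
    · simp
    · simp [HahnSeries.coeff_one, hn]
  map_mul' f g := by
    ext n
    simp only [HahnSeries.coeff_mul, Finset.mul_sum]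
    refine Finset.sum_congr ?_ fun ij hij => ?_
    · ext ij
      simp [Finset.mem_antidiagonal, HahnSeries.mem_support, zpow_ne_zero]
    · rw [← (Finset.mem_antidiagonal.1 hij).2.2, zpow_add, Units.val_mul]
      ring
  map_zero' := by ext n; simp
  map_add' f g := by ext n; simp [mul_add]
  commutes' r := by
    ext n
    rw [algebraMap_complex_apply]
    rcases eq_or_ne n 0 with rfl | hn
    · simp
    · simp [HahnSeries.C_apply, HahnSeries.coeff_single_of_ne hn]

theorem coeff_rotate (ζ : ℂˣ) (f : LaurentSeries ℂ) (n : ℤ) :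
    (rotate ζ f).coeff n = (ζ ^ n : ℂˣ) * f.coeff n := rfl

/-- The action of `ℂˣ` on Laurent series by rescaling the variable. -/
noncomputable def rotateHom : ℂˣ →* (LaurentSeries ℂ →ₐ[ℂ] LaurentSeries ℂ) where
  toFun := rotate
  map_one' := by ext f n; simp [coeff_rotate]
  map_mul' ζ η := by
    ext f n
    simp [coeff_rotate, mul_zpow, mul_assoc]

theorem order_rotate (ζ : ℂˣ) (f : LaurentSeries ℂ) : (rotate ζ f).order = f.order := by
  rcases eq_or_ne f 0 with rfl | hf
  · simp
  have hinj : rotate ζ f ≠ 0 :=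
    (map_ne_zero_iff (rotate ζ) (rotate ζ : LaurentSeries ℂ →+* LaurentSeries ℂ).injective).2 hf
  apply le_antisymm
  · apply HahnSeries.order_le_of_coeff_ne_zero
    rw [coeff_rotate]
    exact mul_ne_zero (Units.ne_zero _) (mt HahnSeries.coeff_order_eq_zero.1 hf)
  · apply HahnSeries.order_le_of_coeff_ne_zero
    have := mt HahnSeries.coeff_order_eq_zero.1 hinj
    rw [coeff_rotate] at this
    exact right_ne_zero_of_mul this

theorem order_single_mul_ofPowerSeries {w : PowerSeries ℂ}
    (hw : PowerSeries.constantCoeff w ≠ 0) (n : ℤ) :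
    (HahnSeries.single n (1 : ℂ) * HahnSeries.ofPowerSeries ℤ ℂ w).order = n := by
  have hcoeff (k : ℤ) : (HahnSeries.single n (1 : ℂ) * HahnSeries.ofPowerSeries ℤ ℂ w).coeff k =
      (HahnSeries.ofPowerSeries ℤ ℂ w).coeff (k - n) := by
    rw [HahnSeries.coeff_single_mul, one_mul]
  have hn : (HahnSeries.single n (1 : ℂ) * HahnSeries.ofPowerSeries ℤ ℂ w).coeff n ≠ 0 := by
    rw [hcoeff, sub_self]
    simpa [PowerSeries.coeff_coe] using hw
  refine le_antisymm (HahnSeries.order_le_of_coeff_ne_zero hn) ?_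
  by_contra hlt
  have h1 := mt HahnSeries.coeff_order_eq_zero.1 (HahnSeries.ne_zero_of_coeff_ne_zero hn)
  rw [hcoeff, PowerSeries.coeff_coe, if_pos (by omega)] at h1
  exact h1 rfl

end LaurentSeries

theorem constantCoeff_eval_scaleRoots_X (p : ℂ[X]) {y : PowerSeries ℂ}
    (hy : PowerSeries.constantCoeff y = 1) :
    PowerSeries.constantCoeff (((p.map (PowerSeries.C (R := ℂ))).scaleRoots PowerSeries.X).eval y) =
      p.leadingCoeff := by
  rcases eq_or_ne p 0 with rfl | hp
  · simp
  rw [← eval_map_apply, hy, map_scaleRoots, map_map]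
  · rw [show (PowerSeries.constantCoeff (R := ℂ)).comp PowerSeries.C = RingHom.id ℂ from
      RingHom.ext fun z => PowerSeries.constantCoeff_C z, map_id]
    simp
  · simpa [leadingCoeff_map_of_injective PowerSeries.C_injective] using hp

theorem exists_eval_scaleRoots_X_eq_one {F : ℂ[X]} (hF : F.Monic) (hd : 0 < F.natDegree) :
    ∃ y : PowerSeries ℂ, PowerSeries.constantCoeff y = 1 ∧
      ((F.map (PowerSeries.C (R := ℂ))).scaleRoots PowerSeries.X).eval y = 1 := by
  set Q : (PowerSeries ℂ)[X] := (F.map (PowerSeries.C (R := ℂ))).scaleRoots PowerSeries.X with hQ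
  have hQm : Q.Monic := (monic_scaleRoots_iff _).2 (hF.map _)
  have hQd : Q.natDegree = F.natDegree := by rw [hQ, natDegree_scaleRoots, hF.natDegree_map]
  have hmap : Q.map (PowerSeries.constantCoeff (R := ℂ)) = X ^ F.natDegree := by
    rw [hQ, map_scaleRoots _ _ _ (by simp [(hF.map _).leadingCoeff]), map_map,
      show (PowerSeries.constantCoeff (R := ℂ)).comp PowerSeries.C = RingHom.id ℂ from
      RingHom.ext fun z => PowerSeries.constantCoeff_C z, map_id]
    simp [hF]
  obtain ⟨y, hy, hy1⟩ := HenselianRing.is_henselian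
    (I := Ideal.span {(PowerSeries.X : PowerSeries ℂ)}) (Q - C 1)
    (hQm.sub_of_left (by
      rw [degree_eq_natDegree hQm.ne_zero, hQd]
      exact degree_C_le.trans_lt (by exact_mod_cast hd))) 1
    (by
      rw [Ideal.mem_span_singleton, PowerSeries.X_dvd_iff, eval_sub, eval_C, map_sub, map_one,
        constantCoeff_eval_scaleRoots_X _ (map_one _), hF.leadingCoeff, sub_self])
    (by
      apply IsUnit.map
      rw [PowerSeries.isUnit_iff_constantCoeff, ← eval_map_apply, ← derivative_map,
        Polynomial.map_sub, hmap]
      simpa [derivative_X_pow] using hd.ne')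
  rw [Ideal.mem_span_singleton, PowerSeries.X_dvd_iff, map_sub, map_one, sub_eq_zero] at hy1
  refine ⟨y, hy1, ?_⟩
  rwa [IsRoot, eval_sub, eval_C, sub_eq_zero] at hy

theorem aeval_single_mul_ofPowerSeries (p : ℂ[X]) (y : PowerSeries ℂ) :
    aeval (HahnSeries.single (-1) 1 * HahnSeries.ofPowerSeries ℤ ℂ y : LaurentSeries ℂ) p =
      HahnSeries.single (-p.natDegree : ℤ) 1 * HahnSeries.ofPowerSeries ℤ ℂ
        (((p.map (PowerSeries.C (R := ℂ))).scaleRoots PowerSeries.X).eval y) := by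
  set x : LaurentSeries ℂ := HahnSeries.single (-1) 1 * HahnSeries.ofPowerSeries ℤ ℂ y with hx
  have h := scaleRoots_eval₂_mul (p := p.map (PowerSeries.C (R := ℂ)))
    (HahnSeries.ofPowerSeries ℤ ℂ) x PowerSeries.X
  have hy : HahnSeries.ofPowerSeries ℤ ℂ PowerSeries.X * x = HahnSeries.ofPowerSeries ℤ ℂ y := by
    rw [hx, ← mul_assoc, HahnSeries.ofPowerSeries_X, HahnSeries.single_mul_single]
    simp
  have hC : (HahnSeries.ofPowerSeries ℤ ℂ).comp PowerSeries.C = algebraMap ℂ (LaurentSeries ℂ) :=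
    RingHom.ext fun z => by
      rw [LaurentSeries.algebraMap_complex_apply, ← HahnSeries.ofPowerSeries_C]; rfl
  rw [hy, eval₂_at_apply, eval₂_map, hC, ← aeval_def,
    natDegree_map_eq_of_injective PowerSeries.C_injective, ← map_pow,
    HahnSeries.ofPowerSeries_X_pow] at h
  rw [h, ← mul_assoc, HahnSeries.single_mul_single]
  simp

/-- The parametrisation of a neighbourhood of infinity by a local parameter `u` such that `F(x)` is
a constant multiple of a power of `u`. -/
theorem nonempty_placeAtInfinity {F : ℂ[X]} (hd : 0 < F.natDegree) :
    Nonempty (PlaceAtInfinity F (LaurentSeries ℂ)) := by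
  have hF0 : F.leadingCoeff ≠ 0 := leadingCoeff_ne_zero.2 (by rintro rfl; simp at hd)
  have hdeg : (C F.leadingCoeff⁻¹ * F).natDegree = F.natDegree :=
    natDegree_C_mul (inv_ne_zero hF0)
  obtain ⟨y, hy, hFy⟩ := exists_eval_scaleRoots_X_eq_one
    (monic_C_mul_of_mul_leadingCoeff_eq_one (inv_mul_cancel₀ hF0)) (by rwa [hdeg])
  set x : LaurentSeries ℂ := HahnSeries.single (-1) 1 * HahnSeries.ofPowerSeries ℤ ℂ y with hx
  have hcoeff (p : ℂ[X]) : (aeval x p).coeff (-p.natDegree : ℤ) = p.leadingCoeff := by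
    rw [hx, aeval_single_mul_ofPowerSeries, HahnSeries.coeff_single_mul, one_mul, sub_self,
      ← constantCoeff_eval_scaleRoots_X p hy, PowerSeries.coeff_coe]
    simp
  have hinj : Function.Injective (aeval x : ℂ[X] → LaurentSeries ℂ) := by
    rw [injective_iff_map_eq_zero]
    intro p hp
    rw [← leadingCoeff_eq_zero, ← hcoeff, hp, HahnSeries.coeff_zero]
  have hFx : aeval x (C F.leadingCoeff⁻¹ * F) = HahnSeries.single (-F.natDegree : ℤ) 1 := by
    rw [hx, aeval_single_mul_ofPowerSeries, hFy, map_one (HahnSeries.ofPowerSeries ℤ ℂ),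
      mul_one, hdeg]
  exact ⟨{
    x := x
    rot := LaurentSeries.rotateHom
    deg := fun f => -f.order
    deg_mul := fun hz hw => by rw [HahnSeries.order_mul hz hw]; ring
    deg_rot := fun ζ z => congrArg Neg.neg (LaurentSeries.order_rotate ζ z)
    deg_aeval := fun p => by
      rcases eq_or_ne p 0 with rfl | hp
      · simp
      rw [hx, aeval_single_mul_ofPowerSeries, LaurentSeries.order_single_mul_ofPowerSeries,
        neg_neg]
      rwa [constantCoeff_eval_scaleRoots_X p hy, Ne, leadingCoeff_eq_zero]
    aeval_injective := hinj
    pow_eq_one_of_rot_aeval := fun ζ p hp h => by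
      have h1 := congrArg (fun f => HahnSeries.coeff f (-p.natDegree : ℤ)) h
      have h2 : ((ζ ^ (-p.natDegree : ℤ) : ℂˣ) : ℂ) * p.leadingCoeff = p.leadingCoeff := by
        rw [← hcoeff]; exact h1
      rw [mul_eq_right₀ (leadingCoeff_ne_zero.2 hp), Units.val_eq_one, zpow_neg, inv_eq_one,
        zpow_natCast] at h2
      exact h2
    rot_aeval_self := fun ζ hζ => by
      have h1 : LaurentSeries.rotate ζ (aeval x (C F.leadingCoeff⁻¹ * F)) =
          aeval x (C F.leadingCoeff⁻¹ * F) := by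
        rw [hFx]
        ext n
        rw [LaurentSeries.coeff_rotate]
        rcases eq_or_ne n (-F.natDegree : ℤ) with rfl | hn
        · rw [zpow_neg, zpow_natCast, hζ, inv_one, Units.val_one, one_mul]
        · rw [HahnSeries.coeff_single_of_ne hn, mul_zero]
      rw [map_mul, map_mul, aeval_C, AlgHom.commutes] at h1
      exact mul_left_cancel₀ ((_root_.map_ne_zero _).2 (inv_ne_zero hF0)) h1 }⟩

theorem eq_of_comp_eq_comp_right {p q h : ℂ[X]} (hh : 0 < h.natDegree)
    (heq : p.comp h = q.comp h) : p = q := by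
  rw [← sub_eq_zero, ← sub_comp, comp_eq_zero_iff] at heq
  rcases heq with h0 | ⟨-, hC⟩
  · exact sub_eq_zero.1 h0
  · rw [hC, natDegree_C] at hh
    exact absurd hh (lt_irrefl 0)

theorem gcd_decomposition
    (a b c d : ℂ[X])
    (ha : 0 < a.natDegree) (hb : 0 < b.natDegree)
    (hc : 0 < c.natDegree) (hd : 0 < d.natDegree)
    (heq : a.comp b = c.comp d) :
    ∃ ahat bhat chat dhat g h : ℂ[X],
      g.comp ahat = a ∧ g.comp chat = c ∧
        g.natDegree = Nat.gcd a.natDegree c.natDegree ∧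
      bhat.comp h = b ∧ dhat.comp h = d ∧
        h.natDegree = Nat.gcd b.natDegree d.natDegree ∧
      ahat.comp bhat = chat.comp dhat := by
  obtain ⟨bhat, dhat, h, rfl, rfl, hh⟩ : ∃ p q h : ℂ[X], p.comp h = b ∧ q.comp h = d ∧
      h.natDegree = Nat.gcd b.natDegree d.natDegree := by
    obtain ⟨P⟩ := nonempty_placeAtInfinity (F := a.comp b)
      (by rw [natDegree_comp]; exact Nat.mul_pos ha hb)
    exact P.exists_common_right_factor hb hd (fun ζ => P.mem_fixed_of_comp_eq ha hb rfl)
      (fun ζ => P.mem_fixed_of_comp_eq hc hd heq.symm)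
  have hh' := hh
  rw [natDegree_comp] at hb hd
  have hb' := Nat.pos_of_mul_pos_right hb
  have hd' := Nat.pos_of_mul_pos_right hd
  have hhpos := Nat.pos_of_mul_pos_left hb
  rw [natDegree_comp, natDegree_comp, Nat.gcd_mul_right] at hh'
  have hcop : Nat.Coprime bhat.natDegree dhat.natDegree :=
    Nat.eq_of_mul_eq_mul_right hhpos (by rw [one_mul, ← hh'])
  have heq' : a.comp bhat = c.comp dhat :=
    eq_of_comp_eq_comp_right hhpos (by rwa [comp_assoc, comp_assoc])
  obtain ⟨ahat, chat, he, hedeg⟩ : ∃ p q : ℂ[X], p.comp bhat = q.comp dhat ∧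
      (q.comp dhat).natDegree = bhat.natDegree * dhat.natDegree := by
    obtain ⟨P⟩ := nonempty_placeAtInfinity (F := a.comp bhat)
      (by rw [natDegree_comp]; exact Nat.mul_pos ha hb')
    exact P.exists_comp_eq_comp hb' hd' (fun ζ => P.mem_fixed_of_comp_eq ha hb' rfl)
      (fun ζ => P.mem_fixed_of_comp_eq hc hd' heq'.symm)
  obtain ⟨g, hg⟩ : ∃ g : ℂ[X], g.comp (chat.comp dhat) = a.comp bhat := by
    refine ((aeval bhat : ℂ[X] →ₐ[ℂ] ℂ[X]).range ⊓
      (aeval dhat : ℂ[X] →ₐ[ℂ] ℂ[X]).range).exists_comp_eq_of_natDegree_dvd ?_ ?_ ?_ ?_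
    · exact ⟨⟨ahat, he⟩, ⟨chat, rfl⟩⟩
    · rw [hedeg]; exact Nat.mul_pos hb' hd'
    · rintro p ⟨⟨q, hq⟩, ⟨s, hs⟩⟩
      rw [hedeg]
      refine hcop.mul_dvd_of_dvd_of_dvd ?_ ?_
      · rw [← show q.comp bhat = p from hq, natDegree_comp]
        exact dvd_mul_left _ _
      · rw [← show s.comp dhat = p from hs, natDegree_comp]
        exact dvd_mul_left _ _
    · exact ⟨⟨a, rfl⟩, ⟨c, heq'.symm⟩⟩
  have hga : g.comp ahat = a :=
    eq_of_comp_eq_comp_right hb' (by rw [comp_assoc, he, hg])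
  have hgc : g.comp chat = c :=
    eq_of_comp_eq_comp_right hd' (by rw [comp_assoc, hg, heq'])
  have had : ahat.natDegree = dhat.natDegree := by
    rw [← he, natDegree_comp, mul_comm] at hedeg
    exact Nat.eq_of_mul_eq_mul_left hb' hedeg
  have hcb : chat.natDegree = bhat.natDegree := by
    rw [natDegree_comp] at hedeg
    exact Nat.eq_of_mul_eq_mul_right hd' hedeg
  refine ⟨ahat, bhat, chat, dhat, g, h, hga, hgc, ?_, rfl, rfl, hh, he⟩
  rw [← hga, ← hgc, natDegree_comp, natDegree_comp, had, hcb, Nat.gcd_mul_left, Nat.gcd_comm,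
    hcop.gcd_eq_one, mul_one]
end

section
/- Suppose a, b, c, d ∈ ℂ[X] are indecomposable and satisfy a ∘ b = c ∘ d. Then either there is a linear ℓ ∈ ℂ[X] such that a = c ∘ ℓ and b = ℓ^{-1} ∘ d, or both gcd(deg a, deg c) = 1 and gcd(deg b, deg d) = 1, in which case deg a = deg d and deg b = deg c. -/
open Polynomial

/-- A polynomial `u ∈ ℂ[X]` is indecomposable if `deg u > 1` and `u` is not the
composition of two polynomials each of degree strictly less than `deg u`. -/
def Indecomposable (u : ℂ[X]) : Prop :=
  1 < u.natDegree ∧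
    ¬ ∃ g h : ℂ[X], g.natDegree < u.natDegree ∧ h.natDegree < u.natDegree ∧ u = g.comp h

namespace Polynomial

section ApproximateRoot

variable {K : Type*} [Field K]

/-- The cofactor of `x - y` in `x ^ (s + 1) - y ^ (s + 1)` for monic `x`, `y` of degree `n`. -/
lemma natDegree_geom_sum₂_le {x y : K[X]} {n : ℕ} (s : ℕ) (hx : x.Monic) (hy : y.Monic)
    (hxn : x.natDegree = n) (hyn : y.natDegree = n) :
    (∑ i ∈ Finset.range (s + 1), x ^ i * y ^ (s - i)).natDegree ≤ n * s ∧
      (∑ i ∈ Finset.range (s + 1), x ^ i * y ^ (s - i)).coeff (n * s) = s + 1 := by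
  have key : ∀ i ∈ Finset.range (s + 1), (x ^ i * y ^ (s - i)).natDegree = n * s := by
    intro i hi
    have hi : i ≤ s := Nat.lt_succ_iff.mp (Finset.mem_range.mp hi)
    rw [(hx.pow i).natDegree_mul (hy.pow _), hx.natDegree_pow, hy.natDegree_pow, hxn, hyn,
      ← Nat.add_mul, Nat.add_sub_cancel' hi, Nat.mul_comm]
  refine ⟨natDegree_sum_le_of_forall_le _ _ fun i hi => (key i hi).le, ?_⟩
  rw [finsetSum_coeff, Finset.sum_congr rfl fun i hi => ?_, Finset.sum_const, Finset.card_range,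
    nsmul_one]
  · push_cast; rfl
  · rw [← key i hi]
    exact ((hx.pow i).mul (hy.pow _)).coeff_natDegree

/-- Over a field of characteristic zero, a monic polynomial of degree `n * (s + 1)` has an
approximate `(s + 1)`-th root of degree `n`. -/
lemma exists_approximateRoot [CharZero K] {a : K[X]} {n s : ℕ} (ha : a.Monic)
    (hdeg : a.natDegree = n * (s + 1)) :
    ∃ u : K[X], u.Monic ∧ u.natDegree = n ∧ (a - u ^ (s + 1)).degree < (n * s : ℕ) := by
  have hs : (s + 1 : K) ≠ 0 := by exact_mod_cast s.succ_ne_zero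
  suffices H : ∀ e ≤ n, ∃ u : K[X], u.Monic ∧ u.natDegree = n ∧
      (a - u ^ (s + 1)).degree < (n * s + e : ℕ) by simpa using H 0 n.zero_le
  intro e he
  induction he using Nat.decreasingInduction with
  | self =>
    refine ⟨X ^ n, monic_X_pow n, natDegree_X_pow n, ?_⟩
    have h : a.degree = (n * s + n : ℕ) := by rw [degree_eq_natDegree ha.ne_zero, hdeg, mul_add_one]
    rw [← h, ← pow_mul]
    refine degree_sub_lt_left ?_ ha.ne_zero ?_
    · rw [degree_X_pow, h, mul_add_one]
    · rw [ha.leadingCoeff, (monic_X_pow _).leadingCoeff]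
  | of_succ e he ih =>
    obtain ⟨u, hu, hun, hlt⟩ := ih
    set r := (a - u ^ (s + 1)).coeff (n * s + e) with hr
    have hv : (C (r / (s + 1)) * X ^ e).degree < u.degree := by
      rw [degree_eq_natDegree hu.ne_zero, hun]
      exact (degree_C_mul_X_pow_le _ _).trans_lt (by exact_mod_cast he)
    have hw : (u + C (r / (s + 1)) * X ^ e).Monic := hu.add_of_left hv
    have hwn : (u + C (r / (s + 1)) * X ^ e).natDegree = n := by
      rw [natDegree_add_eq_left_of_degree_lt hv, hun]
    refine ⟨u + C (r / (s + 1)) * X ^ e, hw, hwn, ?_⟩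
    obtain ⟨hS, hS'⟩ := natDegree_geom_sum₂_le s hw hu hwn hun
    have hgeom := (Commute.all (u + C (r / (s + 1)) * X ^ e) u).geom_sum₂_mul (s + 1)
    simp only [Nat.add_sub_cancel, add_sub_cancel_left] at hgeom
    generalize ∑ i ∈ Finset.range (s + 1), (u + C (r / (s + 1)) * X ^ e) ^ i * u ^ (s - i) = S
      at hS hS' hgeom
    have hsplit : a - (u + C (r / (s + 1)) * X ^ e) ^ (s + 1) =
        (a - u ^ (s + 1)) - C (r / (s + 1)) * S * X ^ e := by
      linear_combination hgeom
    rw [hsplit, degree_lt_iff_coeff_zero]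
    intro k hk
    obtain ⟨k, rfl⟩ := Nat.exists_eq_add_of_le' ((Nat.le_add_left e (n * s)).trans hk)
    rw [coeff_sub, coeff_mul_X_pow, coeff_C_mul]
    rcases (Nat.add_le_add_iff_right.mp hk).eq_or_lt with rfl | hk'
    · rw [hS', ← hr, div_mul_cancel₀ _ hs, sub_self]
    · rw [coeff_eq_zero_of_natDegree_lt (hS.trans_lt hk'), mul_zero, sub_zero]
      exact (degree_lt_iff_coeff_zero _ _).mp hlt _ (by omega)

/-- Approximate roots are unique. -/
lemma eq_of_degree_pow_sub_pow_lt [CharZero K] {x y : K[X]} {n s : ℕ} (hx : x.Monic) (hy : y.Monic)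
    (hxn : x.natDegree = n) (hyn : y.natDegree = n)
    (h : (x ^ (s + 1) - y ^ (s + 1)).degree < (n * s : ℕ)) : x = y := by
  obtain ⟨hS, hS'⟩ := natDegree_geom_sum₂_le s hx hy hxn hyn
  have hgeom := (Commute.all x y).geom_sum₂_mul (s + 1)
  simp only [Nat.add_sub_cancel] at hgeom
  by_contra hne
  rw [← hgeom, degree_mul] at h
  have h1 : (n * s : ℕ) ≤ (∑ i ∈ Finset.range (s + 1), x ^ i * y ^ (s - i)).degree :=
    le_degree_of_ne_zero (by rw [hS']; exact_mod_cast s.succ_ne_zero)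
  have h2 : 0 ≤ (x - y).degree := zero_le_degree_iff.mpr (sub_ne_zero.mpr hne)
  exact absurd h (not_lt.mpr (by simpa using add_le_add h1 h2))

/-- The approximate root of `a.comp b` of degree `n * b.natDegree` is a polynomial in `b`. -/
lemma exists_comp_approximateRoot [CharZero K] {a b : K[X]} {n s : ℕ} (ha : a ≠ 0)
    (hdeg : a.natDegree = n * (s + 1)) (hb : b.natDegree ≠ 0) :
    ∃ u : K[X], u.natDegree = n ∧ (u.comp b).Monic ∧
      (C (a.comp b).leadingCoeff⁻¹ * a.comp b - u.comp b ^ (s + 1)).degree <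
        (n * b.natDegree * s : ℕ) := by
  have hla : a.leadingCoeff ≠ 0 := leadingCoeff_ne_zero.mpr ha
  have hlb : b.leadingCoeff ≠ 0 := leadingCoeff_ne_zero.mpr (by rintro rfl; simp at hb)
  have hmonic : (C a.leadingCoeff⁻¹ * a).Monic := by
    rw [Monic, leadingCoeff_mul, leadingCoeff_C, inv_mul_cancel₀ hla]
  obtain ⟨u, hu, hun, hlt⟩ := exists_approximateRoot (n := n) (s := s) hmonic
    (by rw [natDegree_C_mul (inv_ne_zero hla), hdeg])
  have hc : (b.leadingCoeff ^ n)⁻¹ ≠ 0 := inv_ne_zero (pow_ne_zero _ hlb)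
  refine ⟨C (b.leadingCoeff ^ n)⁻¹ * u, by rw [natDegree_C_mul hc, hun], ?_, ?_⟩
  · rw [Monic, leadingCoeff_comp hb, natDegree_C_mul hc, hun, leadingCoeff_mul, leadingCoeff_C,
      hu.leadingCoeff, mul_one, inv_mul_cancel₀ (pow_ne_zero _ hlb)]
  · have hscale : C (a.comp b).leadingCoeff⁻¹ * a.comp b -
        (C (b.leadingCoeff ^ n)⁻¹ * u).comp b ^ (s + 1) =
        C (b.leadingCoeff ^ (n * (s + 1)))⁻¹ * (C a.leadingCoeff⁻¹ * a - u ^ (s + 1)).comp b := by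
      rw [leadingCoeff_comp hb, hdeg, mul_inv_rev]
      simp only [mul_comp, sub_comp, pow_comp, C_comp, mul_pow, ← C_pow, ← inv_pow, ← pow_mul,
        C_mul]
      ring
    rw [hscale, degree_C_mul (inv_ne_zero (pow_ne_zero _ hlb))]
    rcases eq_or_ne (C a.leadingCoeff⁻¹ * a - u ^ (s + 1)) 0 with h0 | h0
    · rw [h0, zero_comp, degree_zero]
      exact WithBot.bot_lt_coe _
    · have h1 := (natDegree_lt_iff_degree_lt h0).mpr hlt
      refine degree_le_natDegree.trans_lt ?_
      rw [natDegree_comp]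
      have := Nat.mul_lt_mul_of_pos_right h1 (Nat.pos_of_ne_zero hb)
      rw [Nat.mul_right_comm] at this
      exact_mod_cast this

/-- If `u.comp b = v.comp d` has degree `lcm (deg b) (deg d)`, then every common element of `K[b]`
and `K[d]` is a polynomial in it. -/
lemma exists_eq_comp_of_comp_eq {b d u v : K[X]} (hb : b.natDegree ≠ 0) (hd : d.natDegree ≠ 0)
    (huv : u.comp b = v.comp d)
    (hlcm : (u.comp b).natDegree = b.natDegree.lcm d.natDegree) (a c : K[X])
    (h : a.comp b = c.comp d) : ∃ w : K[X], a = w.comp u ∧ c = w.comp v := by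
  have const : ∀ {p q : K[X]} {ρ : K}, q.natDegree ≠ 0 → p.comp q = C ρ → p = C ρ := by
    intro p q ρ hq hp
    have h1 : p.natDegree = 0 := by
      have := congrArg natDegree hp
      rw [natDegree_comp, natDegree_C] at this
      exact (mul_eq_zero.mp this).resolve_right hq
    rw [eq_C_of_natDegree_eq_zero h1, C_comp] at hp
    rw [eq_C_of_natDegree_eq_zero h1, hp]
  have hL : b.natDegree.lcm d.natDegree ≠ 0 := Nat.lcm_ne_zero hb hd
  have hun : u.natDegree ≠ 0 := by
    intro h0
    rw [natDegree_comp, h0, zero_mul] at hlcm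
    exact hL hlcm.symm
  have hvn : v.natDegree ≠ 0 := by
    intro h0
    rw [huv, natDegree_comp, h0, zero_mul] at hlcm
    exact hL hlcm.symm
  have hu0 : u ≠ 0 := by rintro rfl; simp at hun
  have hrem : ∀ {p q r : K[X]}, p.natDegree ≠ 0 → q.natDegree ≠ 0 →
      ((r % p).comp q).natDegree < (p.comp q).natDegree := by
    intro p q r hp hq
    rw [natDegree_comp, natDegree_comp]
    exact Nat.mul_lt_mul_of_pos_right (natDegree_mod_lt _ hp) (Nat.pos_of_ne_zero hq)
  induction hN : a.natDegree using Nat.strong_induction_on generalizing a c with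
  | _ N ih =>
    by_cases ha : a.natDegree = 0
    · rw [eq_C_of_natDegree_eq_zero ha, C_comp] at h
      refine ⟨C (a.coeff 0), ?_, ?_⟩
      · rw [C_comp]; exact eq_C_of_natDegree_eq_zero ha
      · rw [C_comp]; exact const hd h.symm
    have hr := hrem (r := a) hun hb
    have hr' := hrem (r := c) hvn hd
    rw [← huv] at hr'
    have hdiv : u.comp b * ((a / u).comp b - (c / v).comp d) =
        (c % v).comp d - (a % u).comp b := by
      have h1 := congrArg (comp · b) (EuclideanDomain.div_add_mod a u)
      have h2 := congrArg (comp · d) (EuclideanDomain.div_add_mod c v)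
      simp only [add_comp, mul_comp] at h1 h2
      rw [← huv] at h2
      linear_combination h1 - h2 + h
    have hzero : (a / u).comp b - (c / v).comp d = 0 := by
      by_contra hne
      have h1 := congrArg natDegree hdiv
      rw [natDegree_mul (by intro h0; rw [h0, natDegree_zero] at hlcm; exact hL hlcm.symm) hne]
        at h1
      have h2 := natDegree_sub_le ((c % v).comp d) ((a % u).comp b)
      omega
    rw [hzero, mul_zero, eq_comm, sub_eq_zero] at hdiv
    have hdvd : b.natDegree.lcm d.natDegree ∣ ((a % u).comp b).natDegree := by
      refine Nat.lcm_dvd ?_ ?_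
      · rw [natDegree_comp]; exact dvd_mul_left _ _
      · rw [← hdiv, natDegree_comp]; exact dvd_mul_left _ _
    have hrconst := eq_C_of_natDegree_eq_zero (Nat.eq_zero_of_dvd_of_lt hdvd (hlcm ▸ hr))
    have hra := const hb hrconst
    have hrc := const hd (hdiv.trans hrconst)
    have hlt : (a / u).natDegree < N := by
      rw [← hN, div_def, natDegree_C_mul (inv_ne_zero (leadingCoeff_ne_zero.mpr hu0)),
        natDegree_divByMonic _ (monic_mul_leadingCoeff_inv hu0),
        natDegree_mul_leadingCoeff_inv _ hu0]
      omega
    obtain ⟨w, hw, hw'⟩ := ih (a / u).natDegree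
      hlt (a / u) (c / v) (sub_eq_zero.mp hzero) rfl
    refine ⟨X * w + C (((a % u).comp b).coeff 0), ?_, ?_⟩
    · rw [add_comp, mul_comp, X_comp, C_comp, ← hw, ← hra, EuclideanDomain.div_add_mod]
    · rw [add_comp, mul_comp, X_comp, C_comp, ← hw', ← hrc, EuclideanDomain.div_add_mod]

/-- If `a.comp b = c.comp d`, then `K[b] ∩ K[d]` contains an element of degree
`lcm (deg b) (deg d)`, of which `a.comp b` is a polynomial. -/
lemma exists_lcm_left_factor [CharZero K] {a b c d : K[X]} (ha : a.natDegree ≠ 0)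
    (hb : b.natDegree ≠ 0) (hd : d.natDegree ≠ 0) (h : a.comp b = c.comp d) :
    ∃ u v w : K[X], a = w.comp u ∧ c = w.comp v ∧ u.comp b = v.comp d ∧
      (u.comp b).natDegree = b.natDegree.lcm d.natDegree := by
  have hdeg : a.natDegree * b.natDegree = c.natDegree * d.natDegree := by
    simpa [natDegree_comp] using congrArg natDegree h
  have hc : c.natDegree ≠ 0 := by
    intro h0
    rw [h0, zero_mul] at hdeg
    exact mul_ne_zero ha hb hdeg
  have hL : b.natDegree.lcm d.natDegree ∣ a.natDegree * b.natDegree :=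
    Nat.lcm_dvd (dvd_mul_left _ _) (hdeg ▸ dvd_mul_left _ _)
  obtain ⟨t, ht⟩ := hL
  obtain ⟨n, hn⟩ := Nat.dvd_lcm_left b.natDegree d.natDegree
  obtain ⟨m, hm⟩ := Nat.dvd_lcm_right b.natDegree d.natDegree
  have ht0 : t ≠ 0 := by
    rintro rfl
    exact mul_ne_zero ha hb ht
  obtain ⟨s, rfl⟩ := Nat.exists_eq_add_one_of_ne_zero ht0
  have han : a.natDegree = n * (s + 1) := by
    refine Nat.eq_of_mul_eq_mul_right (Nat.pos_of_ne_zero hb) ?_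
    rw [ht, hn]; ring
  have hcm : c.natDegree = m * (s + 1) := by
    refine Nat.eq_of_mul_eq_mul_right (Nat.pos_of_ne_zero hd) ?_
    rw [← hdeg, ht, hm]; ring
  obtain ⟨u, hun, hu, hult⟩ :=
    exists_comp_approximateRoot (by rintro rfl; simp at ha) han hb
  obtain ⟨v, hvm, hv, hvlt⟩ :=
    exists_comp_approximateRoot (by rintro rfl; simp at hc) hcm hd
  have hu' : (u.comp b).natDegree = b.natDegree.lcm d.natDegree := by
    rw [natDegree_comp, hun, hn, mul_comm]
  have hv' : (v.comp d).natDegree = b.natDegree.lcm d.natDegree := by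
    rw [natDegree_comp, hvm, hm, mul_comm]
  have huv : u.comp b = v.comp d := by
    refine eq_of_degree_pow_sub_pow_lt (s := s) hu hv hu' hv' ?_
    rw [mul_comm n, ← hn] at hult
    rw [mul_comm m, ← hm, ← h] at hvlt
    rw [← sub_sub_sub_cancel_left _ _ (C (a.comp b).leadingCoeff⁻¹ * a.comp b)]
    exact (degree_sub_le _ _).trans_lt (max_lt hvlt hult)
  obtain ⟨w, hw, hw'⟩ := exists_eq_comp_of_comp_eq hb hd huv hu' a c h
  exact ⟨u, v, w, hw, hw', huv, hu'⟩

end ApproximateRoot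

section Luroth

open IntermediateField

open scoped RatFunc

variable {K : Type*} [Field K]

lemma transcendental_algebraMap_ratFunc {h : K[X]} (hh : h.natDegree ≠ 0) :
    Transcendental K (algebraMap K[X] (RatFunc K) h) := by
  refine RatFunc.transcendental_of_ne_C _ ?_
  rintro ⟨c, hc⟩
  rw [← RatFunc.algebraMap_C] at hc
  rw [RatFunc.algebraMap_injective K hc, natDegree_C] at hh
  exact hh rfl

lemma natDegree_ne_zero_of_mem_adjoin {h p : K[X]} (hp : p.natDegree ≠ 0)
    (hmem : algebraMap K[X] (RatFunc K) p ∈ K⟮algebraMap K[X] (RatFunc K) h⟯) :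
    h.natDegree ≠ 0 := by
  intro h0
  rw [eq_C_of_natDegree_eq_zero h0, ← algebraMap_eq, ← IsScalarTower.algebraMap_apply,
    adjoin_simple_eq_bot_iff.mpr (_root_.algebraMap_mem _ _)] at hmem
  obtain ⟨c, hc⟩ := mem_bot.mp hmem
  exact transcendental_algebraMap_ratFunc hp (hc ▸ isAlgebraic_algebraMap c)

/-- Elements of `K⟮γ⟯` are fractions of coprime polynomials in `γ`. -/
lemma exists_isCoprime_of_mem_adjoin_simple {L : Type*} [Field L] [Algebra K L] {γ x : L}
    (hγ : Transcendental K γ) (hx : x ∈ K⟮γ⟯) :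
    ∃ P Q : K[X], IsCoprime P Q ∧ Q ≠ 0 ∧ x * aeval γ Q = aeval γ P := by
  obtain ⟨u, hu⟩ := (RatFunc.algEquivOfTranscendental γ hγ).surjective ⟨x, hx⟩
  refine ⟨u.num, u.denom, u.isCoprime_num_denom, u.denom_ne_zero, ?_⟩
  have hne : aeval γ u.denom ≠ 0 := fun h0 => u.denom_ne_zero (transcendental_iff.mp hγ _ h0)
  have := RatFunc.algEquivOfTranscendental_apply γ hγ u
  rw [hu] at this
  rw [show x = _ from this, div_mul_cancel₀ _ hne]

/-- A polynomial which is a rational function of a polynomial `h` is a polynomial in `h`. -/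
lemma exists_eq_comp_of_mem_adjoin {h p : K[X]} (hh : h.natDegree ≠ 0)
    (hp : algebraMap K[X] (RatFunc K) p ∈ K⟮algebraMap K[X] (RatFunc K) h⟯) :
    ∃ P : K[X], p = P.comp h := by
  obtain ⟨P, Q, hPQ, hQ, heq⟩ :=
    exists_isCoprime_of_mem_adjoin_simple (transcendental_algebraMap_ratFunc hh) hp
  have hcomp : ∀ R : K[X], aeval (algebraMap K[X] (RatFunc K) h) R =
      algebraMap K[X] (RatFunc K) (R.comp h) := by
    intro R
    rw [aeval_algebraMap_apply, comp_eq_aeval]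
  rw [hcomp, hcomp, ← map_mul] at heq
  replace heq := RatFunc.algebraMap_injective K heq
  have hunit : IsUnit (Q.comp h) := by
    have hco : IsCoprime (P.comp h) (Q.comp h) := hPQ.map (compRingHom h)
    exact hco.isUnit_of_dvd' (heq ▸ dvd_mul_left _ _) dvd_rfl
  have hQ0 : Q.natDegree = 0 := by
    have := natDegree_eq_zero_of_isUnit hunit
    rw [natDegree_comp] at this
    exact (mul_eq_zero.mp this).resolve_right hh
  rw [eq_C_of_natDegree_eq_zero hQ0] at hQ heq
  rw [C_comp] at heq
  refine ⟨C (Q.coeff 0)⁻¹ * P, ?_⟩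
  rw [mul_comp, C_comp, ← heq, mul_left_comm, ← C_mul, inv_mul_cancel₀ (by simpa using hQ), C_1,
    mul_one]

/-- Clearing denominators in a polynomial expression of a fraction. -/
lemma exists_pow_mul_aeval_eq_algebraMap {p q : K[X]} {γ : RatFunc K}
    (hγ : algebraMap K[X] (RatFunc K) q * γ = algebraMap K[X] (RatFunc K) p) (P : K[X]) :
    ∃ (D : ℕ) (R : K[X]),
      algebraMap K[X] (RatFunc K) q ^ D * aeval γ P = algebraMap K[X] (RatFunc K) R := by
  induction P using Polynomial.induction_on' with
  | add P₁ P₂ h₁ h₂ =>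
    obtain ⟨D₁, R₁, h₁⟩ := h₁
    obtain ⟨D₂, R₂, h₂⟩ := h₂
    refine ⟨D₁ + D₂, q ^ D₂ * R₁ + q ^ D₁ * R₂, ?_⟩
    simp only [map_add, map_mul, map_pow, ← h₁, ← h₂]
    ring
  | monomial n a =>
    refine ⟨n, C a * p ^ n, ?_⟩
    rw [aeval_monomial, map_mul, map_pow, ← hγ, RatFunc.algebraMap_C, RatFunc.algebraMap_eq_C]
    ring

/-- Lüroth's theorem for polynomials: a field of rational functions containing a nonconstant
polynomial is generated by a polynomial. -/
lemma exists_eq_adjoin_algebraMap [IsAlgClosed K] (E : IntermediateField K (RatFunc K)) {b : K[X]}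
    (hb : b.natDegree ≠ 0) (hbE : algebraMap K[X] (RatFunc K) b ∈ E) :
    ∃ h : K[X], E = K⟮algebraMap K[X] (RatFunc K) h⟯ := by
  have hE : E ≠ ⊥ := by
    rintro rfl
    obtain ⟨c, hc⟩ := mem_bot.mp hbE
    exact transcendental_algebraMap_ratFunc hb (hc ▸ isAlgebraic_algebraMap c)
  have hgen := RatFunc.Luroth.eq_adjoin_generator (E := E)
  have htr := RatFunc.Luroth.transcendental_generator hE
  set γ := RatFunc.Luroth.generator E
  obtain ⟨P, Q, hPQ, hQ, heq⟩ := exists_isCoprime_of_mem_adjoin_simple htr (hgen ▸ hbE)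
  have hγ : algebraMap K[X] (RatFunc K) γ.denom * γ = algebraMap K[X] (RatFunc K) γ.num := by
    rw [mul_comm, ← eq_div_iff (RatFunc.algebraMap_ne_zero γ.denom_ne_zero),
      RatFunc.num_div_denom]
  by_cases hQ0 : Q.degree = 0
  · -- `b` is a polynomial in the generator, which is therefore integral over `K[X]`
    obtain ⟨κ, rfl⟩ : ∃ κ, Q = C κ := ⟨_, eq_C_of_degree_eq_zero hQ0⟩
    rw [aeval_C, IsScalarTower.algebraMap_apply K K[X] (RatFunc K), ← map_mul] at heq
    have hP : P.natDegree ≠ 0 := by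
      intro h0
      rw [eq_C_of_natDegree_eq_zero h0, aeval_C,
        IsScalarTower.algebraMap_apply K K[X] (RatFunc K)] at heq
      have := congrArg natDegree (RatFunc.algebraMap_injective K heq)
      rw [algebraMap_eq, natDegree_mul_C (by simpa using hQ), natDegree_C] at this
      exact hb this
    have hintegral : IsIntegral K[X] γ := by
      have hlc : P.leadingCoeff ≠ 0 := leadingCoeff_ne_zero.mpr (by rintro rfl; simp at hP)
      have hmonic : (P * C P.leadingCoeff⁻¹).Monic :=
        monic_mul_leadingCoeff_inv (leadingCoeff_ne_zero.mp hlc)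
      refine IsIntegral.of_aeval_monic (hmonic.map (algebraMap K K[X])) ?_ ?_
      · rwa [natDegree_map, natDegree_mul_C (inv_ne_zero hlc)]
      · rw [aeval_map_algebraMap, map_mul, ← heq, aeval_C,
          IsScalarTower.algebraMap_apply K K[X] (RatFunc K), ← map_mul]
        exact isIntegral_algebraMap
    obtain ⟨h, hh⟩ := IsIntegrallyClosed.isIntegral_iff.mp hintegral
    exact ⟨h, by rw [hh]; exact hgen⟩
  · obtain ⟨α, hα⟩ := IsAlgClosed.exists_root Q hQ0
    obtain ⟨Q₁, rfl⟩ := dvd_iff_isRoot.mpr hα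
    have hPα : P.eval α ≠ 0 := by
      intro h0
      have := hPQ.isUnit_of_dvd' (dvd_iff_isRoot.mpr h0) (dvd_mul_right _ _)
      exact not_isUnit_X_sub_C α this
    obtain ⟨P₁, hP₁⟩ : X - C α ∣ P - C (P.eval α) := X_sub_C_dvd_sub_C_eval
    obtain ⟨D₁, R₁, hR₁⟩ := exists_pow_mul_aeval_eq_algebraMap hγ Q₁
    obtain ⟨D₂, R₂, hR₂⟩ := exists_pow_mul_aeval_eq_algebraMap hγ P₁
    -- the numerator of `γ - α` is coprime to its denominator and divides a power of it
    have hdvd : (b * γ.denom ^ D₂ * R₁ - γ.denom ^ D₁ * R₂) * (γ.num + γ.denom * -C α) =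
        C (P.eval α) * γ.denom ^ (D₁ + D₂ + 1) := by
      apply RatFunc.algebraMap_injective K
      have hP₁' := congrArg (aeval γ) hP₁
      simp only [map_sub, map_mul, aeval_X, aeval_C, RatFunc.algebraMap_eq_C] at hP₁' heq
      simp only [map_add, map_sub, map_mul, map_pow, map_neg, RatFunc.algebraMap_C, ← hR₁, ← hR₂,
        ← hγ]
      linear_combination
        algebraMap K[X] (RatFunc K) γ.denom ^ (D₁ + D₂ + 1) * (heq + hP₁')
    have hcop : IsCoprime (γ.num + γ.denom * -C α) (γ.denom ^ (D₁ + D₂ + 1)) :=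
      (γ.isCoprime_num_denom.add_mul_left_left _).pow_right
    have hunit : IsUnit (γ.num + γ.denom * -C α) :=
      isUnit_of_dvd_unit (hcop.dvd_of_dvd_mul_right (Dvd.intro_left _ hdvd))
        (isUnit_C.mpr hPα.isUnit)
    obtain ⟨σ, hσ, hσeq⟩ := isUnit_iff.mp hunit
    have hγσ : algebraMap K[X] (RatFunc K) γ.denom * (γ - algebraMap K (RatFunc K) α) =
        algebraMap K (RatFunc K) σ := by
      have := congrArg (algebraMap K[X] (RatFunc K)) hσeq
      simp only [map_add, map_mul, map_neg, RatFunc.algebraMap_C, ← hγ] at this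
      rw [RatFunc.algebraMap_eq_C, this]
      ring
    have hσ' : algebraMap K (RatFunc K) σ ≠ 0 := by simpa using hσ.ne_zero
    have hd0 := left_ne_zero_of_mul (hγσ ▸ hσ')
    have hγ0 := right_ne_zero_of_mul (hγσ ▸ hσ')
    refine ⟨γ.denom, hgen.trans (le_antisymm ?_ ?_)⟩
    · have hmem : algebraMap K (RatFunc K) σ / algebraMap K[X] (RatFunc K) γ.denom +
          algebraMap K (RatFunc K) α ∈ K⟮algebraMap K[X] (RatFunc K) γ.denom⟯ :=
        add_mem (div_mem (_root_.algebraMap_mem _ _) (mem_adjoin_simple_self _ _))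
          (_root_.algebraMap_mem _ _)
      rw [← eq_div_of_mul_eq hd0 ((mul_comm _ _).trans hγσ), sub_add_cancel] at hmem
      exact adjoin_simple_le_iff.mpr hmem
    · rw [adjoin_simple_le_iff, eq_div_of_mul_eq hγ0 hγσ]
      exact div_mem (_root_.algebraMap_mem _ _)
        (sub_mem (mem_adjoin_simple_self _ _) (_root_.algebraMap_mem _ _))

/-- If `K⟮b, d⟯` is the whole field of rational functions and `a.comp b = c.comp d`, then
`deg b ≤ deg c`. -/
lemma natDegree_le_of_adjoin_eq_top {a b c d : K[X]} (hc : c.natDegree ≠ 0)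
    (h : a.comp b = c.comp d)
    (htop : K⟮algebraMap K[X] (RatFunc K) b, algebraMap K[X] (RatFunc K) d⟯ = ⊤) :
    b.natDegree ≤ c.natDegree := by
  set β := algebraMap K[X] (RatFunc K) b with hβ
  set δ := algebraMap K[X] (RatFunc K) d with hδ
  have hrank : Module.finrank K⟮β⟯ (RatFunc K) = b.natDegree := by
    rw [RatFunc.finrank_eq_max_natDegree, hβ, RatFunc.num_algebraMap, RatFunc.denom_algebraMap]
    simp
  let f : K⟮β⟯[X] := c.map (algebraMap K K⟮β⟯) - C (aeval (AdjoinSimple.gen K β) a)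
  have hf : f.natDegree = c.natDegree := by
    rw [natDegree_sub_C, natDegree_map]
  have hf0 : f ≠ 0 := by
    intro h0
    rw [h0, natDegree_zero] at hf
    exact hc hf.symm
  have hroot : aeval δ f = 0 := by
    rw [map_sub, aeval_map_algebraMap, aeval_C, ← aeval_algebraMap_apply,
      AdjoinSimple.algebraMap_gen, hβ, hδ, aeval_algebraMap_apply, aeval_algebraMap_apply,
      ← comp_eq_aeval, ← comp_eq_aeval, h, sub_self]
  have hintegral : IsIntegral K⟮β⟯ δ := IsAlgebraic.isIntegral ⟨f, hf0, hroot⟩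
  have htop' : K⟮β⟯⟮δ⟯ = ⊤ := by
    rw [← restrictScalars_eq_top_iff (K := K), adjoin_simple_adjoin_simple]
    exact htop
  have hmin := adjoin.finrank hintegral
  rw [htop', finrank_top', hrank] at hmin
  rw [hmin, ← hf]
  exact natDegree_le_of_dvd (minpoly.dvd _ _ hroot) hf0

end Luroth

end Polynomial

lemma Indecomposable.natDegree_eq_one_or {u g h : ℂ[X]} (hu : Indecomposable u)
    (hgh : u = g.comp h) : g.natDegree = 1 ∨ h.natDegree = 1 := by
  obtain ⟨hdeg, hu⟩ := hu
  by_contra! hne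
  have hmul : u.natDegree = g.natDegree * h.natDegree := by rw [hgh, natDegree_comp]
  have hg : g.natDegree ≠ 0 := by rintro h0; simp [h0] at hmul; omega
  have hh : h.natDegree ≠ 0 := by rintro h0; simp [h0] at hmul; omega
  refine hu ⟨g, h, ?_, ?_, hgh⟩ <;> rw [hmul]
  · exact lt_mul_of_one_lt_right (by omega) (by omega)
  · exact lt_mul_of_one_lt_left (by omega) (by omega)

lemma Polynomial.exists_comp_inverse {K : Type*} [Field K] {p : K[X]} (hp : p.natDegree = 1) :
    ∃ q : K[X], q.natDegree = 1 ∧ p.comp q = X ∧ q.comp p = X := by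
  obtain ⟨r, hr, s, rfl⟩ := natDegree_eq_one.mp hp
  have hrr : C r * C r⁻¹ = (1 : K[X]) := by rw [← C_mul, mul_inv_cancel₀ hr, C_1]
  refine ⟨C r⁻¹ * (X - C s), ?_, ?_, ?_⟩
  · rw [natDegree_C_mul (inv_ne_zero hr), natDegree_X_sub_C]
  · simp only [add_comp, mul_comp, C_comp, X_comp]
    linear_combination (X - C s) * hrr
  · simp only [sub_comp, mul_comp, C_comp, X_comp]
    linear_combination X * hrr

/-- If `b` and `d` have the same image under linear polynomials, then `a.comp b = c.comp d` is
explained by a linear change of variables. -/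
lemma Polynomial.exists_linear_of_comp_eq {K : Type*} [Field K] {a b c d p q : K[X]}
    (hb : b.natDegree ≠ 0) (hp : p.natDegree = 1) (hq : q.natDegree = 1)
    (hpq : p.comp b = q.comp d) (h : a.comp b = c.comp d) :
    ∃ ℓ ℓinv : K[X], ℓ.natDegree = 1 ∧ ℓ.comp ℓinv = X ∧ ℓinv.comp ℓ = X ∧
      a = c.comp ℓ ∧ b = ℓinv.comp d := by
  obtain ⟨p', -, hpp', hp'p⟩ := exists_comp_inverse hp
  obtain ⟨q', hq', hqq', hq'q⟩ := exists_comp_inverse hq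
  have hd : d = (q'.comp p).comp b := by
    rw [comp_assoc, hpq, ← comp_assoc, hq'q, X_comp]
  refine ⟨q'.comp p, p'.comp q, by rw [natDegree_comp, hq', hp], ?_, ?_, ?_, ?_⟩
  · rw [comp_assoc, ← comp_assoc p, hpp', X_comp, hq'q]
  · rw [comp_assoc, ← comp_assoc q, hqq', X_comp, hp'p]
  · have hzero : (a - c.comp (q'.comp p)).comp b = 0 := by
      rw [sub_comp, comp_assoc, ← hd, h, sub_self]
    rcases comp_eq_zero_iff.mp hzero with h0 | ⟨-, h0⟩
    · exact sub_eq_zero.mp h0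
    · rw [h0, natDegree_C] at hb
      exact absurd rfl hb
  · rw [comp_assoc, ← hpq, ← comp_assoc, hp'p, X_comp]

theorem ritt_move_dichotomy
    (a b c d : ℂ[X])
    (ha : Indecomposable a) (hb : Indecomposable b)
    (hc : Indecomposable c) (hd : Indecomposable d)
    (heq : a.comp b = c.comp d) :
    (∃ ℓ ℓinv : ℂ[X], ℓ.natDegree = 1 ∧
        ℓ.comp ℓinv = Polynomial.X ∧ ℓinv.comp ℓ = Polynomial.X ∧
        a = c.comp ℓ ∧ b = ℓinv.comp d) ∨
    (Nat.gcd a.natDegree c.natDegree = 1 ∧ Nat.gcd b.natDegree d.natDegree = 1 ∧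
      a.natDegree = d.natDegree ∧ b.natDegree = c.natDegree) := by
  have ha0 : a.natDegree ≠ 0 := (zero_lt_one.trans ha.1).ne'
  have hb0 : b.natDegree ≠ 0 := (zero_lt_one.trans hb.1).ne'
  have hc0 : c.natDegree ≠ 0 := (zero_lt_one.trans hc.1).ne'
  have hd0 : d.natDegree ≠ 0 := (zero_lt_one.trans hd.1).ne'
  obtain ⟨u, v, w, hau, hcv, huv, hlcm⟩ := exists_lcm_left_factor ha0 hb0 hd0 heq
  by_cases hw : w.natDegree = 1
  swap
  · exact .inl (exists_linear_of_comp_eq hb0 ((ha.natDegree_eq_one_or hau).resolve_left hw)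
      ((hc.natDegree_eq_one_or hcv).resolve_left hw) huv heq)
  have hab : a.natDegree * b.natDegree = b.natDegree.lcm d.natDegree := by
    rw [← hlcm, natDegree_comp, hau, natDegree_comp, hw, one_mul]
  have hcd : c.natDegree * d.natDegree = b.natDegree.lcm d.natDegree := by
    rw [← hlcm, huv, natDegree_comp, hcv, natDegree_comp, hw, one_mul]
  obtain ⟨h, hE⟩ := exists_eq_adjoin_algebraMap
    (IntermediateField.adjoin ℂ {algebraMap ℂ[X] (RatFunc ℂ) b, algebraMap ℂ[X] (RatFunc ℂ) d})
    hb0 (IntermediateField.subset_adjoin _ _ (by simp))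
  have hbE : algebraMap ℂ[X] (RatFunc ℂ) b ∈
      IntermediateField.adjoin ℂ {algebraMap ℂ[X] (RatFunc ℂ) h} :=
    hE ▸ IntermediateField.subset_adjoin _ _ (by simp)
  have hdE : algebraMap ℂ[X] (RatFunc ℂ) d ∈
      IntermediateField.adjoin ℂ {algebraMap ℂ[X] (RatFunc ℂ) h} :=
    hE ▸ IntermediateField.subset_adjoin _ _ (by simp)
  have hh0 : h.natDegree ≠ 0 := natDegree_ne_zero_of_mem_adjoin hb0 hbE
  obtain ⟨b', hb'⟩ := exists_eq_comp_of_mem_adjoin hh0 hbE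
  obtain ⟨d', hd'⟩ := exists_eq_comp_of_mem_adjoin hh0 hdE
  by_cases hh : h.natDegree = 1
  · right
    have hbc : b.natDegree ≤ c.natDegree := by
      refine natDegree_le_of_adjoin_eq_top hc0 heq (hE.trans ?_)
      rw [← IntermediateField.finrank_eq_one_iff_eq_top, RatFunc.finrank_eq_max_natDegree,
        RatFunc.num_algebraMap, RatFunc.denom_algebraMap, hh, natDegree_one]
      rfl
    have hgcd : b.natDegree.gcd d.natDegree = 1 := by
      have hmul := Nat.gcd_mul_lcm b.natDegree d.natDegree
      rw [← hcd, ← mul_assoc] at hmul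
      have hmul' := Nat.eq_of_mul_eq_mul_right (Nat.pos_of_ne_zero hd0) hmul
      have hpos := Nat.gcd_pos_of_pos_left d.natDegree (Nat.pos_of_ne_zero hb0)
      refine le_antisymm (Nat.le_of_mul_le_mul_right ?_ (Nat.pos_of_ne_zero hc0)) hpos
      rwa [hmul', one_mul]
    rw [Nat.Coprime.lcm_eq_mul hgcd] at hab hcd
    have had : a.natDegree = d.natDegree :=
      Nat.eq_of_mul_eq_mul_right (Nat.pos_of_ne_zero hb0) (hab.trans (mul_comm _ _))
    have hcb : c.natDegree = b.natDegree :=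
      Nat.eq_of_mul_eq_mul_right (Nat.pos_of_ne_zero hd0) hcd
    exact ⟨by rw [had, hcb, Nat.gcd_comm, hgcd], hgcd, had, hcb.symm⟩
  · left
    obtain ⟨p, hp, -, hpb⟩ :=
      exists_comp_inverse ((hb.natDegree_eq_one_or hb').resolve_right hh)
    obtain ⟨q, hq, -, hqd⟩ :=
      exists_comp_inverse ((hd.natDegree_eq_one_or hd').resolve_right hh)
    refine exists_linear_of_comp_eq hb0 hp hq ?_ heq
    rw [hb', hd', ← comp_assoc, ← comp_assoc, hpb, hqd]
end

section
/- Suppose a, b, c, d ∈ ℂ[X] are nonconstant and satisfy a ∘ b = c ∘ d and gcd(deg a, deg c) = 1 = gcd(deg b, deg d). Then Mon(a) and Mon(d) are isomorphic as permutation groups, and Mon(b) and Mon(c) are isomorphic as permutation groups. -/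
open Polynomial

/-- The polynomial `u(X) - t` over the rational function field `ℂ(t)`. -/
noncomputable def monPoly (u : ℂ[X]) : Polynomial (RatFunc ℂ) :=
  u.map (RatFunc.C) - Polynomial.C RatFunc.X

/-- `Mon(u)` and `Mon(v)` are isomorphic as permutation groups: there are a group
isomorphism and a compatible bijection between the corresponding root sets. -/
def MonPermIso (u v : ℂ[X]) : Prop :=
  ∃ (φ : (monPoly u).Gal ≃* (monPoly v).Gal)
    (ψ : (monPoly u).rootSet (monPoly u).SplittingField ≃
         (monPoly v).rootSet (monPoly v).SplittingField),
    ∀ (τ : (monPoly u).Gal) (ω : (monPoly u).rootSet (monPoly u).SplittingField),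
      ψ (τ • ω) = φ τ • ψ ω

theorem exists_map_eq_of_eval₂_eq_zero {k L : Type*} [Field k] [IsAlgClosed k] [Field L]
    (ι : k →+* L) {p : k[X]} (hp : p ≠ 0) {x : L} (hx : p.eval₂ ι x = 0) : ∃ z, ι z = x := by
  have hroot : x ∈ (p.map ι).roots := by
    rw [mem_roots (map_ne_zero hp), IsRoot.def, eval_map, hx]
  rw [(IsAlgClosed.splits p).roots_map] at hroot
  obtain ⟨z, -, hz⟩ := Multiset.mem_map.1 hroot
  exact ⟨z, hz⟩

theorem ratFunc_ringHom_ext {k L : Type*} [Field k] [Field L] {f g : RatFunc k →+* L}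
    (hC : f.comp RatFunc.C = g.comp RatFunc.C) (hX : f RatFunc.X = g RatFunc.X) : f = g := by
  refine IsLocalization.ringHom_ext (nonZeroDivisors k[X]) (Polynomial.ringHom_ext ?_ ?_)
  · intro z
    simpa using DFunLike.congr_fun hC z
  · simpa using hX

theorem exists_ratFunc_ringHom {k L : Type*} [Field k] [IsAlgClosed k] [Field L]
    (ι : k →+* L) {s : L} (hs : ∀ z, ι z ≠ s) :
    ∃ j : RatFunc k →+* L, j.comp RatFunc.C = ι ∧ j RatFunc.X = s := by
  have hnz : nonZeroDivisors k[X] ≤ (nonZeroDivisors L).comap (eval₂RingHom ι s) := by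
    intro p hp
    refine mem_nonZeroDivisors_of_ne_zero fun h0 => ?_
    obtain ⟨z, hz⟩ := exists_map_eq_of_eval₂_eq_zero ι (nonZeroDivisors.ne_zero hp) h0
    exact hs z hz
  refine ⟨RatFunc.liftRingHom _ hnz, ?_, ?_⟩
  · ext z
    simp
  · simp

theorem ratFunc_C_ne_X (z : ℂ) : RatFunc.C z ≠ (RatFunc.X : RatFunc ℂ) := by
  rw [← RatFunc.algebraMap_C, ← RatFunc.algebraMap_X]
  exact fun h => X_ne_C z (RatFunc.algebraMap_injective ℂ h).symm

theorem natDegree_monPoly (u : ℂ[X]) : (monPoly u).natDegree = u.natDegree := by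
  rw [monPoly, natDegree_sub_C, natDegree_map]

theorem monPoly_ne_zero {u : ℂ[X]} (hu : 0 < u.natDegree) : monPoly u ≠ 0 :=
  ne_zero_of_natDegree_gt (natDegree_monPoly u ▸ hu)

/-- The solutions in `E` of `u(x) = t`, where `E` is an extension of `ℂ(t)` by means of `j`. -/
def fiberSet {E : Type*} [Field E] (j : RatFunc ℂ →+* E) (u : ℂ[X]) : Set E :=
  {x | u.eval₂ (j.comp RatFunc.C) x = j RatFunc.X}

section fiberSet

variable {E : Type*} [Field E] (j : RatFunc ℂ →+* E)

theorem mem_fiberSet {u : ℂ[X]} {x : E} :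
    x ∈ fiberSet j u ↔ u.eval₂ (j.comp RatFunc.C) x = j RatFunc.X := Iff.rfl

theorem eval₂_monPoly (u : ℂ[X]) (x : E) :
    (monPoly u).eval₂ j x = u.eval₂ (j.comp RatFunc.C) x - j RatFunc.X := by
  rw [monPoly, eval₂_sub, eval₂_map, eval₂_C]

theorem mem_roots_monPoly_iff {u : ℂ[X]} (hu : 0 < u.natDegree) {x : E} :
    x ∈ ((monPoly u).map j).roots ↔ x ∈ fiberSet j u := by
  rw [mem_roots (map_ne_zero (monPoly_ne_zero hu)), IsRoot.def, eval_map, eval₂_monPoly,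
    sub_eq_zero, mem_fiberSet]

theorem fiberSet_eq_coe_roots [DecidableEq E] {u : ℂ[X]} (hu : 0 < u.natDegree) :
    fiberSet j u = ((monPoly u).map j).roots.toFinset := by
  ext x
  rw [Finset.mem_coe, Multiset.mem_toFinset, mem_roots_monPoly_iff j hu]

theorem fiberSet_finite {u : ℂ[X]} (hu : 0 < u.natDegree) : (fiberSet j u).Finite := by
  classical
  rw [fiberSet_eq_coe_roots j hu]
  exact Finset.finite_toSet _

theorem ncard_fiberSet_le {u : ℂ[X]} (hu : 0 < u.natDegree) :
    (fiberSet j u).ncard ≤ u.natDegree := by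
  classical
  rw [fiberSet_eq_coe_roots j hu, Set.ncard_coe_finset]
  refine (Multiset.toFinset_card_le _).trans ((card_roots' _).trans ?_)
  rw [natDegree_map, natDegree_monPoly]

theorem monPoly_map_splits_of_le_ncard {u : ℂ[X]} (hu : 0 < u.natDegree)
    (h : u.natDegree ≤ (fiberSet j u).ncard) : ((monPoly u).map j).Splits := by
  classical
  rw [splits_iff_card_roots]
  refine le_antisymm (card_roots' _) ?_
  rw [natDegree_map, natDegree_monPoly]
  rw [fiberSet_eq_coe_roots j hu, Set.ncard_coe_finset] at h
  exact h.trans (Multiset.toFinset_card_le _)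

theorem ncard_fiberSet [IsAlgClosed E] {u : ℂ[X]} (hu : 0 < u.natDegree) :
    (fiberSet j u).ncard = u.natDegree := by
  classical
  have hder : derivative u ≠ 0 := fun h => hu.ne' (derivative_eq_zero.1 h)
  have hnodup : ((monPoly u).map j).roots.Nodup := by
    refine nodup_roots ?_
    refine (separable_def _).2
      ((isCoprime_iff_aeval_ne_zero_of_isAlgClosed E E _ _).2 fun x => ?_)
    by_contra! hx
    obtain ⟨h0, h1⟩ := hx
    rw [coe_aeval_eq_eval, eval_map, eval₂_monPoly, sub_eq_zero] at h0
    rw [coe_aeval_eq_eval, derivative_map, eval_map, monPoly, derivative_sub, derivative_C,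
      sub_zero, derivative_map, eval₂_map] at h1
    obtain ⟨z, rfl⟩ := exists_map_eq_of_eval₂_eq_zero _ hder h1
    rw [eval₂_at_apply, RingHom.comp_apply] at h0
    exact ratFunc_C_ne_X _ (j.injective h0)
  rw [fiberSet_eq_coe_roots j hu, Set.ncard_coe_finset, Multiset.toFinset_card_of_nodup hnodup,
    splits_iff_card_roots.1 (IsAlgClosed.splits _), natDegree_map, natDegree_monPoly]

theorem comp_eq_of_mem_fixingSubgroup {g : RingAut E}
    (hg : g ∈ fixingSubgroup (RingAut E) (Set.range j)) : (g : E →+* E).comp j = j := by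
  ext x
  exact (mem_fixingSubgroup_iff _).1 hg _ ⟨x, rfl⟩

theorem apply_eval₂_of_mem_fixingSubgroup {g : RingAut E}
    (hg : g ∈ fixingSubgroup (RingAut E) (Set.range j)) (u : ℂ[X]) (x : E) :
    g • u.eval₂ (j.comp RatFunc.C) x = u.eval₂ (j.comp RatFunc.C) (g • x) := by
  have := hom_eval₂ u (j.comp RatFunc.C) (g : E →+* E) x
  rwa [← RingHom.comp_assoc, comp_eq_of_mem_fixingSubgroup j hg] at this

theorem smul_mem_fiberSet {g : RingAut E}
    (hg : g ∈ fixingSubgroup (RingAut E) (Set.range j)) {u : ℂ[X]} {x : E}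
    (hx : x ∈ fiberSet j u) : g • x ∈ fiberSet j u := by
  rw [mem_fiberSet] at hx ⊢
  rw [← apply_eval₂_of_mem_fixingSubgroup j hg, hx]
  exact (mem_fixingSubgroup_iff _).1 hg _ ⟨_, rfl⟩

theorem exists_rootSet_equiv_fiberSet {u : ℂ[X]} (hu : 0 < u.natDegree)
    (hs : ((monPoly u).map j).Splits) :
    ∃ e : (monPoly u).rootSet (monPoly u).SplittingField ≃ fiberSet j u,
      (∀ g ∈ fixingSubgroup (RingAut E) (Set.range j), ∃ τ : (monPoly u).Gal,
        ∀ ω, (e (τ • ω) : E) = g • (e ω : E)) ∧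
      (IsAlgClosed E → j.IsIntegral → ∀ τ : (monPoly u).Gal,
        ∃ g ∈ fixingSubgroup (RingAut E) (Set.range j), ∀ ω, (e (τ • ω) : E) = g • (e ω : E)) := by
  let _ := j.toAlgebra
  have : Fact (((monPoly u).map (algebraMap (RatFunc ℂ) E)).Splits) := ⟨hs⟩
  have hset : (monPoly u).rootSet E = fiberSet j u := by
    classical
    rw [fiberSet_eq_coe_roots j hu, rootSet_def]
    rfl
  have key (g : Gal(E/RatFunc ℂ)) (ω : (monPoly u).rootSet (monPoly u).SplittingField) :
      (Gal.rootsEquivRoots (monPoly u) E (Gal.restrict (monPoly u) E g • ω) : E) =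
        g (Gal.rootsEquivRoots (monPoly u) E ω) := by
    rw [← Gal.restrict_smul, Gal.smul_def, Equiv.symm_apply_apply]
  refine ⟨(Gal.rootsEquivRoots (monPoly u) E).trans (Equiv.setCongr hset), ?_, ?_⟩
  · intro g hg
    exact ⟨Gal.restrict (monPoly u) E
      (AlgEquiv.ofRingEquiv (f := g) fun x => (mem_fixingSubgroup_iff _).1 hg _ ⟨x, rfl⟩),
      fun ω => key _ ω⟩
  · intro hE hj τ
    have : Algebra.IsIntegral (RatFunc ℂ) E := ⟨hj⟩
    have : IsAlgClosure (RatFunc ℂ) E := ⟨hE, inferInstance⟩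
    have : Normal (RatFunc ℂ) E := IsAlgClosure.normal _ _
    obtain ⟨g, rfl⟩ := Gal.restrict_surjective (monPoly u) E τ
    refine ⟨g.toRingEquiv, ?_, fun ω => key g ω⟩
    rw [mem_fixingSubgroup_iff]
    rintro _ ⟨x, rfl⟩
    exact g.commutes x

end fiberSet

theorem monPermIso_of_equiv {u v : ℂ[X]}
    (ψ : (monPoly u).rootSet (monPoly u).SplittingField ≃
      (monPoly v).rootSet (monPoly v).SplittingField)
    (h : ∀ τ : (monPoly u).Gal, ∃ τ' : (monPoly v).Gal, ∀ ω, ψ (τ • ω) = τ' • ψ ω)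
    (h' : ∀ τ' : (monPoly v).Gal, ∃ τ : (monPoly u).Gal, ∀ ω, ψ (τ • ω) = τ' • ψ ω) :
    MonPermIso u v := by
  have faithful (w : ℂ[X]) {τ τ' : (monPoly w).Gal}
      (hτ : ∀ ω : (monPoly w).rootSet (monPoly w).SplittingField, τ • ω = τ' • ω) : τ = τ' :=
    Gal.ext _ fun x hx => congr_arg Subtype.val (hτ ⟨x, hx⟩)
  choose f hf using h
  choose f' hf' using h'
  refine ⟨⟨⟨f, f', fun τ => ?_, fun τ' => ?_⟩, fun σ τ => ?_⟩, ψ, hf⟩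
  · exact faithful u fun ω => ψ.injective (by rw [hf', hf])
  · exact faithful v fun ω => by
      obtain ⟨ω, rfl⟩ := ψ.surjective ω
      rw [← hf, hf']
  · exact faithful v fun ω => by
      obtain ⟨ω, rfl⟩ := ψ.surjective ω
      change f (σ * τ) • ψ ω = (f σ * f τ) • ψ ω
      rw [← hf, mul_smul, mul_smul, ← hf, ← hf]

theorem MonPermIso.symm {u v : ℂ[X]} (h : MonPermIso u v) : MonPermIso v u := by
  obtain ⟨φ, ψ, h⟩ := h
  refine ⟨φ.symm, ψ.symm, fun τ ω => ?_⟩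
  rw [Equiv.symm_apply_eq, h, MulEquiv.apply_symm_apply, Equiv.apply_symm_apply]

theorem monPermIso_of_bijOn {E : Type*} [Field E] [IsAlgClosed E] {j j' : RatFunc ℂ →+* E}
    (hj : j.IsIntegral) (hj' : j'.IsIntegral) {u v : ℂ[X]}
    (hu : 0 < u.natDegree) (hv : 0 < v.natDegree) {f : E → E}
    (hf : Set.BijOn f (fiberSet j u) (fiberSet j' v))
    (h : ∀ g ∈ fixingSubgroup (RingAut E) (Set.range j),
      ∃ g' ∈ fixingSubgroup (RingAut E) (Set.range j'), ∀ x ∈ fiberSet j u, f (g • x) = g' • f x)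
    (h' : ∀ g' ∈ fixingSubgroup (RingAut E) (Set.range j'),
      ∃ g ∈ fixingSubgroup (RingAut E) (Set.range j), ∀ x ∈ fiberSet j u, f (g • x) = g' • f x) :
    MonPermIso u v := by
  obtain ⟨e, he, he'⟩ := exists_rootSet_equiv_fiberSet j hu (IsAlgClosed.splits _)
  obtain ⟨e₁, he₁, he₁'⟩ := exists_rootSet_equiv_fiberSet j' hv (IsAlgClosed.splits _)
  have hψ (ω) : (e₁ (((e.trans (hf.equiv f)).trans e₁.symm) ω) : E) = f (e ω) := by
    simp [Set.BijOn.equiv]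
  refine monPermIso_of_equiv ((e.trans (hf.equiv f)).trans e₁.symm) (fun τ => ?_) fun τ' => ?_
  · obtain ⟨g, hg, hτ⟩ := he' inferInstance hj τ
    obtain ⟨g', hg', hgg'⟩ := h g hg
    obtain ⟨τ', hτ'⟩ := he₁ g' hg'
    refine ⟨τ', fun ω => e₁.injective (Subtype.ext ?_)⟩
    rw [hψ, hτ', hψ, hτ, hgg' _ (e ω).2]
  · obtain ⟨g', hg', hτ'⟩ := he₁' inferInstance hj' τ'
    obtain ⟨g, hg, hgg'⟩ := h' g' hg'
    obtain ⟨τ, hτ⟩ := he g hg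
    refine ⟨τ, fun ω => e₁.injective (Subtype.ext ?_)⟩
    rw [hψ, hτ', hψ, hτ, hgg' _ (e ω).2]

theorem exists_powerSeries_scaleRoots_eval_eq_one {u : ℂ[X]} (hu : 0 < u.natDegree) :
    ∃ S : PowerSeries ℂ, PowerSeries.constantCoeff S ≠ 0 ∧
      ((u.map PowerSeries.C).scaleRoots PowerSeries.X).eval S = 1 := by
  have hu0 : u ≠ 0 := ne_zero_of_natDegree_gt hu
  have hlc : u.leadingCoeff ≠ 0 := leadingCoeff_ne_zero.2 hu0
  set P := (u.map PowerSeries.C).scaleRoots PowerSeries.X with hP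
  set i : ℂ →+* PowerSeries ℂ := PowerSeries.C
  have hPdeg : P.natDegree = u.natDegree := by
    rw [hP, natDegree_scaleRoots, natDegree_map_eq_of_injective PowerSeries.C_injective]
  have hPlc : P.leadingCoeff = i u.leadingCoeff := by
    rw [leadingCoeff, hPdeg, hP, coeff_scaleRoots,
      natDegree_map_eq_of_injective PowerSeries.C_injective]
    simp [i]
  have hPmap : P.map PowerSeries.constantCoeff = C u.leadingCoeff * X ^ u.natDegree := by
    rw [hP, map_scaleRoots _ _ _ (by
      rw [leadingCoeff_map_of_injective PowerSeries.C_injective]; simpa using hu0), map_map]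
    have hid : PowerSeries.constantCoeff.comp i = RingHom.id ℂ := by
      ext z
      simp [i]
    rw [PowerSeries.constantCoeff_X, scaleRoots_zero, hid, map_id, smul_eq_C_mul]
  set Q := C (i u.leadingCoeff⁻¹) * (P - 1) with hQ
  have hQmonic : Q.Monic := by
    refine monic_C_mul_of_mul_leadingCoeff_eq_one ?_
    rw [leadingCoeff_sub_of_degree_lt, hPlc, ← map_mul, inv_mul_cancel₀ hlc, map_one]
    rw [degree_one]
    exact natDegree_pos_iff_degree_pos.1 (hPdeg ▸ hu)
  obtain ⟨s, hs⟩ := IsAlgClosed.exists_pow_nat_eq u.leadingCoeff⁻¹ hu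
  have hs0 : s ≠ 0 := by
    rintro rfl
    rw [zero_pow hu.ne'] at hs
    exact inv_ne_zero hlc hs.symm
  have hQmap : Q.map PowerSeries.constantCoeff = X ^ u.natDegree - C u.leadingCoeff⁻¹ := by
    simp only [hQ, Polynomial.map_mul, Polynomial.map_sub, hPmap, map_C, Polynomial.map_one, i,
      PowerSeries.constantCoeff_C]
    rw [mul_sub, ← mul_assoc, ← C_mul, inv_mul_cancel₀ hlc]
    simp
  have hmem (f : PowerSeries ℂ) :
      f ∈ Ideal.span {PowerSeries.X} ↔ PowerSeries.constantCoeff f = 0 := by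
    rw [Ideal.mem_span_singleton, PowerSeries.X_dvd_iff]
  have hev (R : (PowerSeries ℂ)[X]) : PowerSeries.constantCoeff (R.eval (i s)) =
      (R.map PowerSeries.constantCoeff).eval s := by
    rw [eval_map, eval, hom_eval₂, RingHom.comp_id]
    simp [i]
  obtain ⟨S, hS, hSs⟩ := HenselianRing.is_henselian (I := Ideal.span {PowerSeries.X}) Q hQmonic
    (i s) (by rw [hmem, hev, hQmap]; simp [hs]) (by
      refine IsUnit.map _ ?_
      rw [PowerSeries.isUnit_iff_constantCoeff, hev, ← derivative_map, hQmap]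
      rw [derivative_sub, derivative_C, sub_zero, derivative_X_pow]
      simp [hs0, hu.ne'])
  refine ⟨S, ?_, ?_⟩
  · rw [hmem, map_sub, sub_eq_zero] at hSs
    rw [hSs]
    simpa [i] using hs0
  · rw [IsRoot.def, hQ, eval_mul, eval_C, eval_sub, eval_one, mul_eq_zero, sub_eq_zero] at hS
    refine hS.resolve_left ?_
    simpa [i] using hu0

/-- Multiplication of the variable of a power series by a nonzero scalar, as an automorphism. -/
noncomputable def rescaleEquiv {k : Type*} [Field k] {ζ : k} (hζ : ζ ≠ 0) :
    PowerSeries k ≃+* PowerSeries k :=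
  RingEquiv.ofRingHom (PowerSeries.rescale ζ) (PowerSeries.rescale ζ⁻¹)
    (by rw [← PowerSeries.rescale_mul, inv_mul_cancel₀ hζ, PowerSeries.rescale_one])
    (by rw [← PowerSeries.rescale_mul, mul_inv_cancel₀ hζ, PowerSeries.rescale_one])

theorem exists_ringAut_pow_smul_injOn (L : Type*) [Field L] [Algebra (PowerSeries ℂ) L]
    [IsFractionRing (PowerSeries ℂ) L] {u : ℂ[X]} (hu : 0 < u.natDegree) :
    ∃ j : RatFunc ℂ →+* L,
      ∃ ρ ∈ fixingSubgroup (RingAut L) (Set.range j), ∃ r ∈ fiberSet j u,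
        Set.InjOn (fun k : ℕ => ρ ^ k • r) (Set.Iio u.natDegree) := by
  obtain ⟨S, hS0, hS⟩ := exists_powerSeries_scaleRoots_eval_eq_one hu
  let A : PowerSeries ℂ →+* L := algebraMap _ _
  have hA : Function.Injective A := IsFractionRing.injective _ _
  have hw : A PowerSeries.X ≠ 0 := by
    rw [Ne, map_eq_zero_iff A hA]
    exact PowerSeries.X_ne_zero
  obtain ⟨j, hjC, hjX⟩ := exists_ratFunc_ringHom (A.comp PowerSeries.C)
    (s := (A PowerSeries.X ^ u.natDegree)⁻¹) (by
      intro z hz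
      replace hz : A (PowerSeries.C z * PowerSeries.X ^ u.natDegree) = A 1 := by
        rw [map_mul, map_pow, map_one]
        exact (congrArg (· * _) hz).trans (inv_mul_cancel₀ (pow_ne_zero _ hw))
      replace hz := hA hz
      have := congr_arg PowerSeries.constantCoeff hz
      simp [hu.ne'] at this)
  have hζ := Complex.isPrimitiveRoot_exp u.natDegree hu.ne'
  set ζ := Complex.exp (2 * Real.pi * Complex.I / u.natDegree)
  have hζ0 : ζ ≠ 0 := hζ.ne_zero hu.ne'
  let ρ : RingAut L := IsFractionRing.ringEquivOfRingEquiv (rescaleEquiv hζ0)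
  have hρA (f : PowerSeries ℂ) : ρ • A f = A (PowerSeries.rescale ζ f) :=
    IsFractionRing.ringEquivOfRingEquiv_algebraMap _ _
  have hρpow (k : ℕ) (f : PowerSeries ℂ) : ρ ^ k • A f = A (PowerSeries.rescale (ζ ^ k) f) := by
    induction k with
    | zero => simp
    | succ k ih => rw [pow_succ', mul_smul, ih, hρA, PowerSeries.rescale_rescale, pow_succ]
  have hcc (k : ℕ) :
      PowerSeries.constantCoeff (PowerSeries.rescale (ζ ^ k) S) = PowerSeries.constantCoeff S := by
    rw [← PowerSeries.coeff_zero_eq_constantCoeff_apply, PowerSeries.coeff_rescale, pow_zero,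
      one_mul, PowerSeries.coeff_zero_eq_constantCoeff_apply]
  refine ⟨j, ρ, ?_, A S / A PowerSeries.X, ?_, ?_⟩
  · have hcomp : ((ρ : L ≃+* L) : L →+* L).comp j = j := by
      refine ratFunc_ringHom_ext ?_ ?_
      · rw [RingHom.comp_assoc, hjC]
        ext z
        change ρ • A (PowerSeries.C z) = A (PowerSeries.C z)
        rw [hρA]
        congr 1
        ext n
        rw [PowerSeries.coeff_rescale, PowerSeries.coeff_C]
        split_ifs with hn <;> simp [hn]
      · change ρ • j RatFunc.X = j RatFunc.X
        rw [hjX, smul_inv'', smul_pow', hρA, PowerSeries.rescale_X, map_mul, mul_pow, ← map_pow,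
          ← map_pow, hζ.pow_eq_one]
        simp
    rw [mem_fixingSubgroup_iff]
    rintro _ ⟨x, rfl⟩
    exact DFunLike.congr_fun hcomp x
  · have := scaleRoots_eval₂_mul (p := u.map PowerSeries.C) A (A S / A PowerSeries.X)
      PowerSeries.X
    rw [mul_div_cancel₀ _ hw, eval₂_at_apply, hS, map_one, eval₂_map,
      natDegree_map_eq_of_injective PowerSeries.C_injective] at this
    rw [mem_fiberSet, hjC, hjX]
    exact eq_inv_of_mul_eq_one_right this.symm
  · intro k hk l hl hkl
    have h : A S / A PowerSeries.X = A S * (A PowerSeries.X)⁻¹ := div_eq_mul_inv _ _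
    simp only [h, smul_mul', smul_inv'', hρpow, PowerSeries.rescale_X, map_mul] at hkl
    have hne (k : ℕ) : A (PowerSeries.C (ζ ^ k)) ≠ 0 := by
      rw [Ne, map_eq_zero_iff A hA]
      simpa using fun h => absurd h hζ0
    have hkl' : A (PowerSeries.rescale (ζ ^ k) S) * A (PowerSeries.C (ζ ^ l)) =
        A (PowerSeries.rescale (ζ ^ l) S) * A (PowerSeries.C (ζ ^ k)) := by
      have := hne k
      have := hne l
      field_simp at hkl
      linear_combination hkl
    rw [← map_mul, ← map_mul] at hkl'
    have := congr_arg PowerSeries.constantCoeff (hA hkl')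
    rw [map_mul, map_mul, hcc, hcc, PowerSeries.constantCoeff_C,
      PowerSeries.constantCoeff_C] at this
    exact hζ.pow_inj hk hl (mul_left_cancel₀ hS0 this).symm

theorem exists_gal_zpow_smul_eq {u : ℂ[X]} (hu : 0 < u.natDegree) :
    ∃ τ : (monPoly u).Gal, ∀ ω ω' : (monPoly u).rootSet (monPoly u).SplittingField,
      ∃ k : ℤ, τ ^ k • ω = ω' := by
  obtain ⟨j, ρ, hρ, r, hr, hinj⟩ :=
    exists_ringAut_pow_smul_injOn (FractionRing (PowerSeries ℂ)) hu
  have hsub : (fun k : ℕ => ρ ^ k • r) '' Set.Iio u.natDegree ⊆ fiberSet j u := by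
    rintro _ ⟨k, -, rfl⟩
    exact smul_mem_fiberSet j (pow_mem hρ k) hr
  have hcard : ((fun k : ℕ => ρ ^ k • r) '' Set.Iio u.natDegree).ncard = u.natDegree := by
    rw [hinj.ncard_image, ← Nat.card_coe_set_eq]
    simp
  have hfin := fiberSet_finite j hu
  obtain ⟨e, he, -⟩ := exists_rootSet_equiv_fiberSet j hu
    (monPoly_map_splits_of_le_ncard j hu (hcard.symm.le.trans (Set.ncard_le_ncard hsub hfin)))
  have heq := Set.eq_of_subset_of_ncard_le hsub
    ((ncard_fiberSet_le j hu).trans hcard.symm.le) hfin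
  obtain ⟨τ, hτ⟩ := he ρ hρ
  have hpow (k : ℕ) (ω) : (e (τ ^ k • ω)).1 = ρ ^ k • (e ω).1 := by
    induction k with
    | zero => simp
    | succ k ih => rw [pow_succ', mul_smul, hτ, ih, pow_succ', mul_smul]
  have hbase (ω) : ∃ k : ℕ, τ ^ k • e.symm ⟨r, hr⟩ = ω := by
    obtain ⟨k, -, hk⟩ := heq.symm.subset (e ω).2
    refine ⟨k, e.injective (Subtype.ext ?_)⟩
    rw [hpow, Equiv.apply_symm_apply]
    exact hk
  refine ⟨τ, fun ω ω' => ?_⟩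
  obtain ⟨k, rfl⟩ := hbase ω
  obtain ⟨l, rfl⟩ := hbase ω'
  refine ⟨l - k, ?_⟩
  rw [← zpow_natCast τ k, smul_smul, ← zpow_add, sub_add_cancel, zpow_natCast]

theorem zpow_smul_eq_zpow_smul_of_modEq {G α : Type*} [Group G] [MulAction G α] {σ : G} {T : Set α}
    (hσ : ∀ x ∈ T, ∀ k : ℤ, σ ^ k • x ∈ T)
    (hT : ∀ x ∈ T, ∀ y ∈ T, ∃ k : ℤ, σ ^ k • x = y) {x : α} (hx : x ∈ T) {k l : ℤ}
    (hkl : k ≡ l [ZMOD T.ncard]) : σ ^ k • x = σ ^ l • x := by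
  have horbit : MulAction.orbit (Subgroup.zpowers σ) x = T := by
    ext y
    constructor
    · rintro ⟨⟨_, m, rfl⟩, rfl⟩
      exact hσ x hx m
    · intro hy
      obtain ⟨m, rfl⟩ := hT x hx y hy
      exact ⟨⟨_, m, rfl⟩, rfl⟩
  have hper : MulAction.period σ x = T.ncard := by
    rw [MulAction.period, ← horbit, ← Nat.card_coe_set_eq]
    rw [Nat.card_congr (MulAction.orbitZPowersEquiv σ x), Nat.card_zmod]
  rw [← MulAction.zpow_mod_period_smul k (g := σ), ← MulAction.zpow_mod_period_smul l (g := σ),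
    hper, hkl]

theorem exists_ringAut_zpow_smul_eq {E : Type*} [Field E] [IsAlgClosed E] {j : RatFunc ℂ →+* E}
    (hj : j.IsIntegral) {u : ℂ[X]} (hu : 0 < u.natDegree) :
    ∃ σ ∈ fixingSubgroup (RingAut E) (Set.range j), ∀ x ∈ fiberSet j u, ∀ y ∈ fiberSet j u,
      ∃ k : ℤ, σ ^ k • x = y := by
  obtain ⟨e, -, he⟩ := exists_rootSet_equiv_fiberSet j hu (IsAlgClosed.splits _)
  obtain ⟨τ, hτ⟩ := exists_gal_zpow_smul_eq hu
  obtain ⟨σ, hσ, hτσ⟩ := he inferInstance hj τ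
  have hτσ' (ω) : (e (τ⁻¹ • ω) : E) = σ⁻¹ • (e ω : E) := by
    rw [eq_inv_smul_iff, ← hτσ, smul_inv_smul]
  have hpow (k : ℤ) : ∀ ω, (e (τ ^ k • ω) : E) = σ ^ k • (e ω : E) := by
    induction k with
    | zero => simp
    | succ k ih =>
      intro ω
      rw [zpow_add_one, mul_smul, ih, hτσ, zpow_add_one, mul_smul]
    | pred k ih =>
      intro ω
      rw [zpow_sub_one, mul_smul, ih, hτσ', zpow_sub_one, mul_smul]
  refine ⟨σ, hσ, fun x hx y hy => ?_⟩
  obtain ⟨k, hk⟩ := hτ (e.symm ⟨x, hx⟩) (e.symm ⟨y, hy⟩)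
  refine ⟨k, ?_⟩
  have := hpow k (e.symm ⟨x, hx⟩)
  rwa [hk, Equiv.apply_symm_apply, Equiv.apply_symm_apply, eq_comm] at this

theorem eval₂_mem_fiberSet_of_mem_fiberSet_comp {E : Type*} [Field E] {j : RatFunc ℂ →+* E}
    {p q : ℂ[X]} {x : E} (hx : x ∈ fiberSet j (p.comp q)) :
    q.eval₂ (j.comp RatFunc.C) x ∈ fiberSet j p := by
  rwa [mem_fiberSet, ← eval₂_comp]

theorem exists_zpow_smul_eq_of_comp {E : Type*} [Field E] [IsAlgClosed E] {j : RatFunc ℂ →+* E}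
    {p q : ℂ[X]} (hq : 0 < q.natDegree) {σ : RingAut E}
    (hσ : σ ∈ fixingSubgroup (RingAut E) (Set.range j))
    (h : ∀ x ∈ fiberSet j (p.comp q), ∀ y ∈ fiberSet j (p.comp q), ∃ k : ℤ, σ ^ k • x = y) :
    ∀ x ∈ fiberSet j p, ∀ y ∈ fiberSet j p, ∃ k : ℤ, σ ^ k • x = y := by
  have hlift (x) (hx : x ∈ fiberSet j p) :
      ∃ x' ∈ fiberSet j (p.comp q), q.eval₂ (j.comp RatFunc.C) x' = x := by
    obtain ⟨x', hx'⟩ := IsAlgClosed.exists_root (q.map (j.comp RatFunc.C) - C x) (by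
      refine (natDegree_pos_iff_degree_pos.1 ?_).ne'
      rwa [natDegree_sub_C, natDegree_map])
    rw [IsRoot.def, eval_sub, eval_map, eval_C, sub_eq_zero] at hx'
    exact ⟨x', by rwa [mem_fiberSet, eval₂_comp, hx'], hx'⟩
  intro x hx y hy
  obtain ⟨x', hx', rfl⟩ := hlift x hx
  obtain ⟨y', hy', rfl⟩ := hlift y hy
  obtain ⟨k, rfl⟩ := h x' hx' y' hy'
  exact ⟨k, apply_eval₂_of_mem_fixingSubgroup j (zpow_mem hσ k) _ _⟩

theorem natDegree_eq_of_comp_eq_comp {a b c d : ℂ[X]}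
    (heq : a.comp b = c.comp d) (hac : a.natDegree.Coprime c.natDegree)
    (hbd : b.natDegree.Coprime d.natDegree) : a.natDegree = d.natDegree := by
  have h := congr_arg natDegree heq
  rw [natDegree_comp, natDegree_comp] at h
  exact Nat.dvd_antisymm (hac.dvd_of_dvd_mul_left (h ▸ dvd_mul_right _ _))
    (hbd.symm.dvd_of_dvd_mul_right (h ▸ dvd_mul_left _ _))

theorem monPermIso_of_comp_eq_comp {a b c d : ℂ[X]} (ha : 0 < a.natDegree) (hb : 0 < b.natDegree)
    (hc : 0 < c.natDegree) (hd : 0 < d.natDegree) (heq : a.comp b = c.comp d)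
    (hac : a.natDegree.Coprime c.natDegree) (hbd : b.natDegree.Coprime d.natDegree) :
    MonPermIso d a := by
  let E := AlgebraicClosure (RatFunc ℂ)
  let j : RatFunc ℂ →+* E := algebraMap _ _
  have hj : j.IsIntegral := fun x => Algebra.IsIntegral.isIntegral x
  obtain ⟨σ, hσ, hcyc⟩ := exists_ringAut_zpow_smul_eq hj (u := a.comp b)
    (by rw [natDegree_comp]; positivity)
  have hcyc_a := exists_zpow_smul_eq_of_comp hb hσ hcyc
  have hcyc_c := exists_zpow_smul_eq_of_comp hd hσ (heq ▸ hcyc)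
  have hmem (u : ℂ[X]) (x : E) (hx : x ∈ fiberSet j u) (k : ℤ) : σ ^ k • x ∈ fiberSet j u :=
    smul_mem_fiberSet j (zpow_mem hσ k) hx
  have hmod (u : ℂ[X]) (hu : 0 < u.natDegree)
      (h : ∀ x ∈ fiberSet j u, ∀ y ∈ fiberSet j u, ∃ k : ℤ, σ ^ k • x = y) {x : E}
      (hx : x ∈ fiberSet j u) {k l : ℤ} (hkl : k ≡ l [ZMOD u.natDegree]) :
      σ ^ k • x = σ ^ l • x :=
    zpow_smul_eq_zpow_smul_of_modEq (hmem u) h hx (by rwa [ncard_fiberSet j hu])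
  obtain ⟨z, hz⟩ : (fiberSet j c).Nonempty := by
    rw [← Set.ncard_pos (fiberSet_finite j hc), ncard_fiberSet j hc]
    exact hc
  obtain ⟨j', hj'C, hj'X⟩ := exists_ratFunc_ringHom (j.comp RatFunc.C) (s := z) (by
    rintro y rfl
    rw [mem_fiberSet, eval₂_at_apply, RingHom.comp_apply] at hz
    exact ratFunc_C_ne_X _ (j.injective hz))
  obtain ⟨i, hi⟩ : ∃ i : RatFunc ℂ →+* RatFunc ℂ, j'.comp i = j := by
    have hX : j' (c.eval₂ RatFunc.C RatFunc.X) = j RatFunc.X := by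
      rw [hom_eval₂, hj'C, hj'X]
      exact hz
    obtain ⟨i, hiC, hiX⟩ := exists_ratFunc_ringHom RatFunc.C (s := c.eval₂ RatFunc.C RatFunc.X) (by
      intro y hy
      rw [← hy] at hX
      exact ratFunc_C_ne_X y (j.injective ((DFunLike.congr_fun hj'C y).symm.trans hX)))
    refine ⟨i, ratFunc_ringHom_ext ?_ ?_⟩
    · rw [RingHom.comp_assoc, hiC, hj'C]
    · rw [RingHom.comp_apply, hiX, hX]
  have hj' : j'.IsIntegral := RingHom.IsIntegral.tower_top i j' (hi ▸ hj)
  have hle : fixingSubgroup (RingAut E) (Set.range j') ≤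
      fixingSubgroup (RingAut E) (Set.range j) := by
    refine fixingSubgroup_antitone _ _ ?_
    rw [← hi]
    exact Set.range_comp_subset_range i j'
  have hfix (g) (hg : g ∈ fixingSubgroup (RingAut E) (Set.range j)) (hgz : g • z = z) :
      g ∈ fixingSubgroup (RingAut E) (Set.range j') := by
    have hcomp : ((g : E ≃+* E) : E →+* E).comp j' = j' := by
      refine ratFunc_ringHom_ext ?_ ?_
      · rw [RingHom.comp_assoc, hj'C, ← RingHom.comp_assoc, comp_eq_of_mem_fixingSubgroup j hg]
      · rw [RingHom.comp_apply, hj'X]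
        exact hgz
    rw [mem_fixingSubgroup_iff]
    rintro _ ⟨x, rfl⟩
    exact DFunLike.congr_fun hcomp x
  -- the automorphisms fixing `z` realise every permutation of the roots of `a(X) - t`
  have hlift (g) (hg : g ∈ fixingSubgroup (RingAut E) (Set.range j)) :
      ∃ g' ∈ fixingSubgroup (RingAut E) (Set.range j'), ∀ y ∈ fiberSet j a, g' • y = g • y := by
    obtain ⟨k, hk⟩ := hcyc_c z hz _ (smul_mem_fiberSet j hg hz)
    obtain ⟨l, hla, hlc⟩ : ∃ l : ℤ, l ≡ 0 [ZMOD a.natDegree] ∧ l ≡ k [ZMOD c.natDegree] := by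
      obtain ⟨v, w, hvw⟩ := Nat.isCoprime_iff_coprime.2 hac
      exact ⟨k * (v * a.natDegree), Int.modEq_zero_iff_dvd.2 ⟨k * v, by ring⟩,
        (Int.modEq_iff_dvd.2 ⟨k * w, by linear_combination -k * hvw⟩)⟩
    refine ⟨(σ ^ l)⁻¹ * g, hfix _ (mul_mem (inv_mem (zpow_mem hσ l)) hg) ?_, fun y hy => ?_⟩
    · rw [mul_smul, inv_smul_eq_iff, ← hk, hmod c hc hcyc_c hz hlc]
    · rw [mul_smul, inv_smul_eq_iff,
        hmod a ha hcyc_a (smul_mem_fiberSet j hg hy) hla, zpow_zero, one_smul]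
  have hmaps : Set.MapsTo (fun x => b.eval₂ (j.comp RatFunc.C) x) (fiberSet j' d)
      (fiberSet j a) := by
    intro x hx
    refine eval₂_mem_fiberSet_of_mem_fiberSet_comp ?_
    rw [mem_fiberSet, hj'C, hj'X] at hx
    rw [heq, mem_fiberSet, eval₂_comp, hx]
    exact hz
  have hsurj : Set.SurjOn (fun x => b.eval₂ (j.comp RatFunc.C) x) (fiberSet j' d)
      (fiberSet j a) := by
    obtain ⟨x, hx⟩ : (fiberSet j' d).Nonempty := by
      rw [← Set.ncard_pos (fiberSet_finite j' hd), ncard_fiberSet j' hd]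
      exact hd
    intro y hy
    obtain ⟨k, rfl⟩ := hcyc_a _ (hmaps hx) y hy
    obtain ⟨g, hg, hgy⟩ := hlift _ (zpow_mem hσ k)
    refine ⟨g • x, smul_mem_fiberSet j' hg hx, ?_⟩
    rw [← hgy _ (hmaps hx)]
    exact (apply_eval₂_of_mem_fixingSubgroup j (hle hg) b x).symm
  have hcard : (fiberSet j' d).ncard = (fiberSet j a).ncard := by
    rw [ncard_fiberSet j ha, ncard_fiberSet j' hd, natDegree_eq_of_comp_eq_comp heq hac hbd]
  have hinj : Set.InjOn (fun x => b.eval₂ (j.comp RatFunc.C) x) (fiberSet j' d) :=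
    fun x hx y hy hxy => Set.inj_on_of_surj_on_of_ncard_le (t := fiberSet j a)
      (fun x _ => b.eval₂ (j.comp RatFunc.C) x) (fun x hx => hmaps hx)
      (fun y hy => by simpa [eq_comm] using hsurj hy) hcard.le hx hy hxy (fiberSet_finite j' hd)
  refine monPermIso_of_bijOn hj' hj hd ha ⟨hmaps, hinj, hsurj⟩ (fun g hg => ?_) fun g hg => ?_
  · exact ⟨g, hle hg, fun x _ => (apply_eval₂_of_mem_fixingSubgroup j (hle hg) b x).symm⟩
  · obtain ⟨g', hg', hgg'⟩ := hlift g hg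
    refine ⟨g', hg', fun x hx => ?_⟩
    rw [← hgg' _ (hmaps hx)]
    exact (apply_eval₂_of_mem_fixingSubgroup j (hle hg') b x).symm

theorem monodromy_iso_of_coprime_decompositions
    (a b c d : ℂ[X])
    (ha : 0 < a.natDegree) (hb : 0 < b.natDegree)
    (hc : 0 < c.natDegree) (hd : 0 < d.natDegree)
    (heq : a.comp b = c.comp d)
    (hac : Nat.gcd a.natDegree c.natDegree = 1)
    (hbd : Nat.gcd b.natDegree d.natDegree = 1) :
    MonPermIso a d ∧ MonPermIso b c :=
  ⟨(monPermIso_of_comp_eq_comp ha hb hc hd heq hac hbd).symm,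
    monPermIso_of_comp_eq_comp hc hd ha hb heq.symm (Nat.Coprime.symm hac) (Nat.Coprime.symm hbd)⟩
end
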